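/- Let r ≥ 2 be an integer, let k_1, …, k_r be positive integers, and let x_1, …, x_r be roots of unity with (k_1, x_1) ≠ (1,1), (k_r, x_r) ≠ (1,1) and x_1 x_2 ⋯ x_r ≠ 1. Then t_{k_1,…,k_r}(x_1,…,x_r) − (−1)^{k_1+⋯+k_r−1} (x_1⋯x_r) · t_{k_r,…,k_1}(x_r^{−1},…,x_1^{−1}) belongs to the K-subalgebra of ℂ generated by all cyclotomic multiple zeta values of depth at most r − 1 together with all cyclotomic multiple t-values of depth at most r − 1. -/

import Mathlib

open Filter Finset

/-- A complex number is a root of unity if some positive power of it equals 1. -/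
def IsRootOfUnity (z : ℂ) : Prop := ∃ N : ℕ, 0 < N ∧ z ^ N = 1

open scoped Classical in
/-- Partial sum `Σ_{0<n_1<⋯<n_r≤N} Π_j x_j^{n_j} (n_j + b_j − 1)^{−k_j}` where the list `K`
consists of the triples `(k_j, x_j, b_j)`. -/
noncomputable def cmhzP (K : List (ℕ × ℂ × ℂ)) (N : ℕ) : ℂ :=
  ∑ n ∈ Finset.univ.filter (fun n : Fin K.length → Fin N => StrictMono n),
    ∏ j : Fin K.length,
      (K.get j).2.1 ^ ((n j : ℕ) + 1) /
        ((((n j : ℕ) + 1 : ℕ) : ℂ) + (K.get j).2.2 - 1) ^ (K.get j).1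

/-- Cyclotomic multiple Hurwitz zeta value: the limit of the partial sums `cmhzP`. -/
noncomputable def cmhz (K : List (ℕ × ℂ × ℂ)) : ℂ := limUnder atTop (cmhzP K)

/-- Cyclotomic multiple zeta value (all Hurwitz parameters equal to 1). -/
noncomputable def cmzv (K : List (ℕ × ℂ)) : ℂ := cmhz (K.map fun p => (p.1, p.2, 1))

/-- Cyclotomic multiple t-value (all Hurwitz parameters equal to 1/2). -/
noncomputable def tval (K : List (ℕ × ℂ)) : ℂ := cmhz (K.map fun p => (p.1, p.2, (1 : ℂ)/2))

/-- Depth-one cyclotomic zeta value `Li_k(x)`. -/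
noncomputable def li1 (k : ℕ) (x : ℂ) : ℂ := cmzv [(k, x)]

/-- Depth-one cyclotomic Hurwitz zeta value `Li_k(x; b)`. -/
noncomputable def lih1 (k : ℕ) (x b : ℂ) : ℂ := cmhz [(k, x, b)]

/-- Depth-one cyclotomic t-value `t_k(x)`. -/
noncomputable def tval1 (k : ℕ) (x : ℂ) : ℂ := tval [(k, x)]

/-- The generalized digamma-type series `φ(s; x) = Σ_{k≥0} x^k/(k+s)`. -/
noncomputable def phiF (s x : ℂ) : ℂ :=
  limUnder atTop (fun N : ℕ => ∑ t ∈ Finset.range (N + 1), x ^ t / ((t : ℂ) + s))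

/-- The extended trigonometric function `Φ(s; x) = φ(s; x) − φ(−s; x⁻¹) − 1/s`. -/
noncomputable def PhiF (s x : ℂ) : ℂ := phiF s x - phiF (-s) x⁻¹ - 1 / s

/-- Nested sum `Σ_{a<n_1<⋯<n_r≤b} Π f_i(n_i)`. -/
noncomputable def nest : List (ℤ → ℂ) → ℤ → ℤ → ℂ
  | [], _, _ => 1
  | f :: fs, a, b => ∑ n ∈ Finset.Ioc a b, f n * nest fs n b

theorem nest_nil (a b : ℤ) : nest [] a b = 1 := rfl
theorem nest_cons (f : ℤ → ℂ) (fs) (a b : ℤ) :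
    nest (f :: fs) a b = ∑ n ∈ Finset.Ioc a b, f n * nest fs n b := rfl

theorem sum_Ioc_split (f : ℤ → ℂ) {a b c : ℤ} (h1 : a ≤ c) (h2 : c ≤ b) :
    ∑ n ∈ Finset.Ioc a b, f n = ∑ n ∈ Finset.Ioc a c, f n + ∑ n ∈ Finset.Ioc c b, f n := by
  rw [← Finset.sum_union]
  · congr 1
    ext n; simp only [Finset.mem_Ioc, Finset.mem_union]; omega
  · rw [Finset.disjoint_left]; intro n; simp only [Finset.mem_Ioc]; omega

theorem nest_split (fs : List (ℤ → ℂ)) : ∀ {a b c : ℤ}, a ≤ c → c ≤ b →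
    nest fs a b = ∑ i ∈ Finset.range (fs.length + 1),
      nest (fs.take i) a c * nest (fs.drop i) c b := by
  induction fs with
  | nil => intro a b c h1 h2; simp [nest_nil]
  | cons f fs ih =>
    intro a b c h1 h2
    rw [List.length_cons, Finset.sum_range_succ']
    simp only [List.take_succ_cons, List.drop_succ_cons, List.take_zero, List.drop_zero, nest_nil,
      one_mul]
    rw [nest_cons, sum_Ioc_split _ h1 h2, ← nest_cons]
    congr 1
    simp only [nest_cons, Finset.sum_mul]
    rw [Finset.sum_comm]
    refine Finset.sum_congr rfl fun n hn => ?_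
    rw [Finset.mem_Ioc] at hn
    rw [ih hn.2 h2, Finset.mul_sum]
    exact Finset.sum_congr rfl fun i _ => by ring

theorem nest_append (fs : List (ℤ → ℂ)) (f : ℤ → ℂ) (gs : List (ℤ → ℂ)) (b : ℤ) : ∀ a : ℤ,
    nest (fs ++ f :: gs) a b
      = ∑ n ∈ Finset.Ioc a b, nest fs a (n - 1) * f n * nest gs n b := by
  induction fs with
  | nil => intro a; simp [nest_nil, nest_cons]
  | cons g fs ih =>
    intro a
    rw [List.cons_append, nest_cons]
    simp only [ih, Finset.mul_sum, nest_cons, Finset.sum_mul]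
    rw [Finset.sum_sigma', Finset.sum_sigma']
    refine Finset.sum_bij' (fun p _ => ⟨p.2, p.1⟩) (fun p _ => ⟨p.2, p.1⟩) ?_ ?_ ?_ ?_ ?_
    · rintro ⟨p, q⟩; simp only [Finset.mem_sigma, Finset.mem_Ioc]; omega
    · rintro ⟨p, q⟩; simp only [Finset.mem_sigma, Finset.mem_Ioc]; omega
    · intros; rfl
    · intros; rfl
    · intros; ring

theorem nest_snoc (fs : List (ℤ → ℂ)) (f : ℤ → ℂ) (a b : ℤ) :
    nest (fs ++ [f]) a b = ∑ n ∈ Finset.Ioc a b, nest fs a (n - 1) * f n := by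
  rw [nest_append]; simp [nest_nil]

theorem nest_shift {α : Type*} (fs : List α) (F : α → ℤ → ℂ) (c b : ℤ) : ∀ a : ℤ,
    nest (fs.map F) a b = nest (fs.map fun p n => F p (n + c)) (a - c) (b - c) := by
  induction fs with
  | nil => intro a; rfl
  | cons f fs ih =>
    intro a
    simp only [List.map_cons, nest_cons]
    refine Finset.sum_bij' (fun n _ => n - c) (fun n _ => n + c) ?_ ?_ ?_ ?_ ?_
    · intro n; simp only [Finset.mem_Ioc]; omega
    · intro n; simp only [Finset.mem_Ioc]; omega
    · intros; ring
    · intros; ring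
    · intro n hn; rw [ih n, sub_add_cancel]

theorem nest_reflect {α : Type*} (fs : List α) (F : α → ℤ → ℂ) (c b : ℤ) : ∀ a : ℤ,
    nest (fs.map F) a b =
      nest (fs.reverse.map fun p n => F p (c - n)) (c - b - 1) (c - a - 1) := by
  induction fs with
  | nil => intro a; rfl
  | cons f fs ih =>
    intro a
    simp only [List.map_cons, nest_cons, List.reverse_cons, List.map_append, List.map_nil,
      nest_snoc]
    refine Finset.sum_bij' (fun n _ => c - n) (fun n _ => c - n) ?_ ?_ ?_ ?_ ?_
    · intro n; simp only [Finset.mem_Ioc]; omega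
    · intro n; simp only [Finset.mem_Ioc]; omega
    · intros; ring
    · intros; ring
    · intro n hn; rw [ih n, sub_sub_cancel, mul_comm]

theorem nest_scale {α : Type*} (fs : List α) (F : α → ℤ → ℂ) (c : α → ℂ) (b : ℤ) : ∀ a : ℤ,
    nest (fs.map fun p n => c p * F p n) a b = (fs.map c).prod * nest (fs.map F) a b := by
  induction fs with
  | nil => intro a; simp [nest_nil]
  | cons f fs ih =>
    intro a
    simp only [List.map_cons, nest_cons, List.prod_cons, Finset.mul_sum]
    refine Finset.sum_congr rfl fun n _ => ?_
    rw [ih]; ring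

open scoped Classical in
/-- Strictly increasing integer tuples in `(a, b]`. -/
noncomputable def tup (r : ℕ) (a b : ℤ) : Finset (Fin r → ℤ) :=
  (Fintype.piFinset fun _ => Finset.Ioc a b).filter StrictMono

theorem mem_tup {r : ℕ} {a b : ℤ} {n : Fin r → ℤ} :
    n ∈ tup r a b ↔ (∀ i, a < n i ∧ n i ≤ b) ∧ StrictMono n := by
  simp [tup]

theorem strictMono_cons_iff {r : ℕ} (m : ℤ) (n : Fin r → ℤ) :
    StrictMono (Fin.cons m n : Fin (r + 1) → ℤ) ↔ (∀ i, m < n i) ∧ StrictMono n := by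
  constructor
  · intro h
    refine ⟨fun i => ?_, fun i j hij => ?_⟩
    · have := h (Fin.succ_pos i); simpa using this
    · have := h (Fin.succ_lt_succ_iff.mpr hij); simpa using this
  · rintro ⟨h1, h2⟩ i j hij
    induction j using Fin.cases with
    | zero => exact absurd hij (by simp)
    | succ j =>
      induction i using Fin.cases with
      | zero => simpa using h1 j
      | succ i => simpa using h2 (Fin.succ_lt_succ_iff.mp hij)

theorem nest_ofFn : ∀ (r : ℕ) (f : Fin r → ℤ → ℂ) (a b : ℤ),
    ∑ n ∈ tup r a b, ∏ i, f i (n i) = nest (List.ofFn f) a b := by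
  intro r
  induction r with
  | zero =>
    intro f a b
    have : tup 0 a b = {Fin.elim0} := by
      ext n
      rw [mem_tup, Finset.mem_singleton]
      refine ⟨fun _ => Subsingleton.elim _ _, fun _ => ⟨fun i => i.elim0, fun i => i.elim0⟩⟩
    simp [this, nest_nil]
  | succ r ih =>
    intro f a b
    rw [List.ofFn_succ, nest_cons]
    simp only [← ih, Finset.mul_sum]
    rw [Finset.sum_sigma']
    refine Finset.sum_bij' (fun n _ => ⟨n 0, Fin.tail n⟩) (fun p _ => Fin.cons p.1 p.2)
      ?_ ?_ ?_ ?_ ?_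
    · intro n hn
      rw [mem_tup] at hn
      have h2 := hn.2
      rw [← Fin.cons_self_tail n, strictMono_cons_iff] at h2
      simp only [Finset.mem_sigma, Finset.mem_Ioc, mem_tup]
      exact ⟨hn.1 0, fun i => ⟨h2.1 i, (hn.1 i.succ).2⟩, h2.2⟩
    · rintro ⟨m, n⟩ h
      simp only [Finset.mem_sigma, Finset.mem_Ioc, mem_tup] at h
      rw [mem_tup, strictMono_cons_iff]
      refine ⟨fun i => ?_, fun i => (h.2.1 i).1, h.2.2⟩
      induction i using Fin.cases with
      | zero => simpa using h.1
      | succ i => simpa using ⟨h.1.1.trans (h.2.1 i).1, (h.2.1 i).2⟩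
    · intro n _; exact Fin.cons_self_tail n
    · rintro ⟨m, n⟩ _; simp
    · intro n _; rw [Fin.prod_univ_succ]; rfl

/-- The summand attached to `(k, x)` with Hurwitz parameter `b`. -/
noncomputable def fz (b : ℂ) (p : ℕ × ℂ) (n : ℤ) : ℂ := p.2 ^ n / ((n : ℂ) + b - 1) ^ p.1

theorem cmhzP_eq (K : List (ℕ × ℂ)) (b : ℂ) (N : ℕ) :
    cmhzP (K.map fun p => (p.1, p.2, b)) N = nest (K.map (fz b)) 0 N := by
  have h : K.map (fz b) = List.ofFn
      (fun j : Fin (K.map fun p => (p.1, p.2, b)).length =>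
        fz b (((K.map fun p => (p.1, p.2, b)).get j).1,
          ((K.map fun p => (p.1, p.2, b)).get j).2.1)) := by
    apply List.ext_getElem
    · simp
    · intro i h1 h2; simp
  rw [h, ← nest_ofFn, cmhzP]
  have hb : ∀ j, ((K.map fun p => (p.1, p.2, b)).get j).2.2 = b := by intro j; simp
  refine Finset.sum_bij' (fun n _ j => ((n j : ℕ) : ℤ) + 1)
    (fun n hn j => ⟨(n j - 1).toNat, by
      have := (mem_tup.mp hn).1 j; omega⟩) ?_ ?_ ?_ ?_ ?_
  · intro n hn
    simp only [Finset.mem_filter, Finset.mem_univ, true_and] at hn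
    rw [mem_tup]
    refine ⟨fun i => ?_, fun i j hij => ?_⟩
    · have := (n i).2; omega
    · have : (n i : ℕ) < n j := hn hij
      show ((n i : ℕ) : ℤ) + 1 < ((n j : ℕ) : ℤ) + 1
      omega
  · intro n hn
    have hn' := mem_tup.mp hn
    simp only [Finset.mem_filter, Finset.mem_univ, true_and]
    intro i j hij
    have := hn'.2 hij
    have := hn'.1 i
    rw [Fin.lt_def]
    show (n i - 1).toNat < (n j - 1).toNat
    omega
  · intro n hn; ext j; simp
  · intro n hn; ext j
    have := (mem_tup.mp hn).1 j
    show (((n j - 1).toNat : ℕ) : ℤ) + 1 = n j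
    omega
  · intro n hn
    refine Finset.prod_congr rfl fun j _ => ?_
    rw [hb, fz]
    push_cast
    congr 1

/-! ### Partial fractions -/

/-- The building blocks of the partial fraction decomposition. -/
noncomputable def pfG {r : ℕ} (j : Fin r) (l : ℕ) (e : Fin r → ℕ) (y : Fin r → ℂ) : ℂ :=
  ((y j) ^ l)⁻¹ * ∏ i ∈ Finset.univ.erase j, ((y i - y j) ^ (e i))⁻¹

/-- The span of the building blocks compatible with `k`. -/
noncomputable def pfV {r : ℕ} (k : Fin r → ℕ) : Submodule ℚ ((Fin r → ℂ) → ℂ) :=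
  Submodule.span ℚ {φ | ∃ j l e, 1 ≤ l ∧ (∀ i, i ≠ j → k i ≤ e i) ∧ φ = pfG j l e}

theorem hasDerivAt_inv_pow (c : ℂ) (e : ℕ) (t : ℂ) (h : c - t ≠ 0) :
    HasDerivAt (fun t => ((c - t) ^ e)⁻¹) ((e : ℂ) * ((c - t) ^ (e + 1))⁻¹) t := by
  have h1 : HasDerivAt (fun t : ℂ => c - t) (-1) t := (hasDerivAt_id t).const_sub c
  have h2 := (h1.fun_pow e).fun_inv (pow_ne_zero e h)
  refine h2.congr_deriv ?_
  rcases e with _ | e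
  · simp
  · field_simp
    simp
    ring

theorem pfG_deriv {r : ℕ} (k : Fin r → ℕ) (m : Fin r) (j : Fin r) (l : ℕ) (e : Fin r → ℕ)
    (hl : 1 ≤ l) (he : ∀ i, i ≠ j → k i ≤ e i) :
    ∃ G ∈ pfV (Function.update k m (k m + 1)), ∀ y : Fin r → ℂ, Function.Injective y →
      (∀ i, y i ≠ 0) →
      HasDerivAt (fun t => pfG j l e (Function.update y m t)) (G y) (y m) := by
  by_cases hjm : j = m
  · subst hjm
    have hk' : ∀ i, i ≠ j → Function.update k j (k j + 1) i ≤ e i := by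
      intro i hi; rw [Function.update_of_ne hi]; exact he i hi
    refine ⟨(-(l : ℚ)) • pfG j (l + 1) e + ∑ i ∈ Finset.univ.erase j,
      ((e i : ℕ) : ℚ) • pfG j l (Function.update e i (e i + 1)), ?_, ?_⟩
    · refine Submodule.add_mem _ (Submodule.smul_mem _ _ (Submodule.subset_span
        ⟨j, l + 1, e, by omega, hk', rfl⟩)) (Submodule.sum_mem _ fun i hi =>
          Submodule.smul_mem _ _ (Submodule.subset_span ⟨j, l, _, hl, ?_, rfl⟩))
      intro i' hi'
      refine (hk' i' hi').trans ?_
      by_cases h : i' = i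
      · subst h; simp
      · rw [Function.update_of_ne h]
    · intro y hy hy0
      have e1 : (fun t => pfG j l e (Function.update y j t)) = fun t =>
          (t ^ l)⁻¹ * ∏ i ∈ Finset.univ.erase j, ((y i - t) ^ (e i))⁻¹ := by
        funext t
        rw [pfG]
        simp only [Function.update_self]
        congr 1
        refine Finset.prod_congr rfl fun i hi => ?_
        rw [Function.update_of_ne (Finset.ne_of_mem_erase hi)]
      rw [e1]
      have d1 : HasDerivAt (fun t : ℂ => (t ^ l)⁻¹) (-(l : ℂ) * ((y j) ^ (l + 1))⁻¹) (y j) := by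
        have h2 := (hasDerivAt_pow l (y j)).fun_inv (pow_ne_zero l (hy0 j))
        refine h2.congr_deriv ?_
        obtain ⟨l, rfl⟩ : ∃ l', l = l' + 1 := ⟨l - 1, by omega⟩
        have := hy0 j
        field_simp
        simp
        ring
      have d2 := HasDerivAt.fun_finsetProd (u := Finset.univ.erase j)
        (f := fun i t => ((y i - t) ^ (e i))⁻¹) (x := y j)
        (f' := fun i => (e i : ℂ) * ((y i - y j) ^ (e i + 1))⁻¹)
        (fun i hi => hasDerivAt_inv_pow (y i) (e i) (y j)
          (sub_ne_zero.mpr fun h => (Finset.ne_of_mem_erase hi) (hy h)))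
      refine (d1.mul d2).congr_deriv ?_
      simp only [Pi.add_apply, Pi.smul_apply, Finset.sum_apply, pfG, Finset.mul_sum]
      congr 1
      · rw [Rat.smul_def]; push_cast; ring
      · refine Finset.sum_congr rfl fun i hi => ?_
        rw [Rat.smul_def, ← Finset.mul_prod_erase _ _ hi, Function.update_self, smul_eq_mul]
        have : ∏ x ∈ (Finset.univ.erase j).erase i,
            ((y x - y j) ^ (Function.update e i (e i + 1) x))⁻¹
            = ∏ x ∈ (Finset.univ.erase j).erase i, ((y x - y j) ^ (e x))⁻¹ :=
          Finset.prod_congr rfl fun x hx => by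
            rw [Function.update_of_ne (Finset.ne_of_mem_erase hx)]
        rw [this]; push_cast; ring
  · have hm : m ∈ Finset.univ.erase j := by simp [Ne.symm hjm]
    refine ⟨(-((e m : ℕ) : ℚ)) • pfG j l (Function.update e m (e m + 1)),
      Submodule.smul_mem _ _ (Submodule.subset_span ⟨j, l, _, hl, ?_, rfl⟩), ?_⟩
    · intro i hi
      by_cases h : i = m
      · subst h; simpa using he i hi
      · rw [Function.update_of_ne h, Function.update_of_ne h]; exact he i hi
    · intro y hy hy0
      have e1 : (fun t => pfG j l e (Function.update y m t)) = fun t =>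
          (((y j) ^ l)⁻¹ * ∏ i ∈ (Finset.univ.erase j).erase m, ((y i - y j) ^ (e i))⁻¹) *
            (-1) ^ (e m) * ((y j - t) ^ (e m))⁻¹ := by
        funext t
        rw [pfG, ← Finset.mul_prod_erase _ _ hm]
        simp only [Function.update_self, Function.update_of_ne hjm]
        have : ∏ x ∈ (Finset.univ.erase j).erase m,
            ((Function.update y m t x - y j) ^ (e x))⁻¹
            = ∏ x ∈ (Finset.univ.erase j).erase m, ((y x - y j) ^ (e x))⁻¹ :=
          Finset.prod_congr rfl fun x hx => by
            rw [Function.update_of_ne (Finset.ne_of_mem_erase hx)]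
        rw [this]
        have h2 : ((t - y j) ^ (e m))⁻¹ = (-1) ^ (e m) * ((y j - t) ^ (e m))⁻¹ := by
          rw [← neg_sub (y j) t, neg_pow, mul_inv, ← inv_pow]; norm_num
        rw [h2]; ring
      rw [e1]
      have hne : y j - y m ≠ 0 := sub_ne_zero.mpr fun h => hjm (hy h)
      refine ((hasDerivAt_inv_pow (y j) (e m) (y m) hne).const_mul _).congr_deriv ?_
      rw [Pi.smul_apply, Rat.smul_def, pfG, ← Finset.mul_prod_erase _ _ hm, Function.update_self]
      have : ∏ x ∈ (Finset.univ.erase j).erase m,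
            ((y x - y j) ^ (Function.update e m (e m + 1) x))⁻¹
            = ∏ x ∈ (Finset.univ.erase j).erase m, ((y x - y j) ^ (e x))⁻¹ :=
          Finset.prod_congr rfl fun x hx => by
            rw [Function.update_of_ne (Finset.ne_of_mem_erase hx)]
      rw [this]
      have h2 : ((y m - y j) ^ (e m + 1))⁻¹ = (-1) ^ (e m + 1) * ((y j - y m) ^ (e m + 1))⁻¹ := by
        rw [← neg_sub (y j) (y m), neg_pow, mul_inv, ← inv_pow]; norm_num
      rw [h2]; push_cast; ring

theorem pfV_deriv {r : ℕ} (k : Fin r → ℕ) (m : Fin r) (F : (Fin r → ℂ) → ℂ) (hF : F ∈ pfV k) :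
    ∃ G ∈ pfV (Function.update k m (k m + 1)), ∀ y : Fin r → ℂ, Function.Injective y →
      (∀ i, y i ≠ 0) →
      HasDerivAt (fun t => F (Function.update y m t)) (G y) (y m) := by
  refine Submodule.span_induction ?_ ?_ ?_ ?_ hF
  · rintro _ ⟨j, l, e, hl, he, rfl⟩
    exact pfG_deriv k m j l e hl he
  · exact ⟨0, Submodule.zero_mem _, fun y _ _ => hasDerivAt_const _ _⟩
  · rintro F1 F2 _ _ ⟨G1, h1, d1⟩ ⟨G2, h2, d2⟩
    exact ⟨G1 + G2, Submodule.add_mem _ h1 h2, fun y hy hy0 => (d1 y hy hy0).add (d2 y hy hy0)⟩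
  · rintro c F1 _ ⟨G1, h1, d1⟩
    refine ⟨c • G1, Submodule.smul_mem _ _ h1, fun y hy hy0 => ?_⟩
    have := (d1 y hy hy0).const_mul (c : ℂ)
    simpa only [Pi.smul_apply, Rat.smul_def] using this

theorem pf_base {r : ℕ} (hr : 0 < r) (y : Fin r → ℂ) (hy : Function.Injective y)
    (hy0 : ∀ i, y i ≠ 0) :
    ∏ i, ((y i) ^ 1)⁻¹ = ∑ j, pfG j 1 (fun _ => 1) y := by
  have hs := Lagrange.sum_basis (s := Finset.univ) (v := y) hy.injOn ⟨⟨0, hr⟩, Finset.mem_univ _⟩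
  have h0 := congrArg (Polynomial.eval 0) hs
  simp only [Polynomial.eval_finsetSum, Lagrange.basis, Polynomial.eval_prod,
    Lagrange.basisDivisor, Polynomial.eval_mul, Polynomial.eval_C, Polynomial.eval_sub,
    Polynomial.eval_X, Polynomial.eval_one, zero_sub] at h0
  rw [← mul_one (∏ i, _), ← h0, Finset.mul_sum]
  refine Finset.sum_congr rfl fun j _ => ?_
  rw [pfG, ← Finset.mul_prod_erase _ _ (Finset.mem_univ j), mul_assoc, ← Finset.prod_mul_distrib]
  congr 1
  refine Finset.prod_congr rfl fun i hi => ?_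
  have h1 : y j - y i ≠ 0 := sub_ne_zero.mpr fun h => (Finset.ne_of_mem_erase hi) (hy h).symm
  have h2 : y i - y j ≠ 0 := sub_ne_zero.mpr fun h => (Finset.ne_of_mem_erase hi) (hy h)
  have := hy0 i
  field_simp
  ring

theorem pf_exists {r : ℕ} (hr : 0 < r) : ∀ (s : ℕ) (k : Fin r → ℕ), (∀ i, 1 ≤ k i) →
    ∑ i, k i = s →
    ∃ G ∈ pfV k, ∀ y : Fin r → ℂ, Function.Injective y → (∀ i, y i ≠ 0) →
      ∏ i, ((y i) ^ (k i))⁻¹ = G y := by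
  intro s
  induction s with
  | zero =>
    intro k hk hs
    have h1 := hk ⟨0, hr⟩
    have := (Finset.sum_eq_zero_iff.mp hs) ⟨0, hr⟩ (Finset.mem_univ _)
    omega
  | succ s ih =>
    intro k hk hs
    by_cases hall : ∀ i, k i = 1
    · obtain rfl : k = fun _ => 1 := funext hall
      refine ⟨∑ j, pfG j 1 (fun _ => 1), Submodule.sum_mem _ fun j _ =>
        Submodule.subset_span ⟨j, 1, _, le_rfl, fun _ _ => le_rfl, rfl⟩, fun y hy hy0 => ?_⟩
      rw [pf_base hr y hy hy0, Finset.sum_apply]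
    · push Not at hall
      obtain ⟨m, hm⟩ := hall
      have hm2 : 2 ≤ k m := by have := hk m; omega
      set k' := Function.update k m (k m - 1) with hk'
      have hkm : k' m = k m - 1 := by simp [hk']
      have hkk : Function.update k' m (k' m + 1) = k := by
        rw [hkm, hk', Function.update_idem]
        have : k m - 1 + 1 = k m := by omega
        rw [this, Function.update_eq_self]
      have hne : ∀ i, i ≠ m → k' i = k i := fun i hi => by rw [hk', Function.update_of_ne hi]
      have hk1 : ∀ i, 1 ≤ k' i := by
        intro i
        by_cases h : i = m
        · subst h; omega
        · rw [hne i h]; exact hk i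
      have hs' : ∑ i, k' i = s := by
        have a1 := Finset.add_sum_erase Finset.univ k (Finset.mem_univ m)
        have a2 := Finset.add_sum_erase Finset.univ k' (Finset.mem_univ m)
        have a3 : ∑ i ∈ Finset.univ.erase m, k' i = ∑ i ∈ Finset.univ.erase m, k i :=
          Finset.sum_congr rfl fun i hi => hne i (Finset.ne_of_mem_erase hi)
        omega
      obtain ⟨F, hF, hFy⟩ := ih k' hk1 hs'
      obtain ⟨G, hG, hGy⟩ := pfV_deriv k' m F hF
      rw [hkk] at hG
      refine ⟨(-((k' m : ℕ) : ℚ)⁻¹) • G, Submodule.smul_mem _ _ hG, fun y hy hy0 => ?_⟩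
      have d1 := hGy y hy hy0
      have d2 : HasDerivAt (fun t => (t ^ (k' m))⁻¹ *
          ∏ i ∈ Finset.univ.erase m, ((y i) ^ (k i))⁻¹)
          ((-(k' m : ℂ) * ((y m) ^ (k m))⁻¹) * ∏ i ∈ Finset.univ.erase m, ((y i) ^ (k i))⁻¹)
          (y m) := by
        refine HasDerivAt.mul_const ?_ _
        have h2 := (hasDerivAt_pow (k' m) (y m)).fun_inv (pow_ne_zero _ (hy0 m))
        refine h2.congr_deriv ?_
        have hy1 := hy0 m
        obtain ⟨q, hq⟩ : ∃ q, k' m = q + 1 := ⟨k' m - 1, by have := hk1 m; omega⟩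
        have hq2 : k m = q + 2 := by omega
        rw [hq, hq2]
        field_simp
        simp
        ring
      have hev : (fun t => F (Function.update y m t)) =ᶠ[nhds (y m)] (fun t => (t ^ (k' m))⁻¹ *
          ∏ i ∈ Finset.univ.erase m, ((y i) ^ (k i))⁻¹) := by
        have c1 : ∀ᶠ t in nhds (y m), t ≠ 0 := isOpen_ne.mem_nhds (hy0 m)
        have c2 : ∀ᶠ t in nhds (y m), ∀ i, i ≠ m → t ≠ y i := by
          rw [Filter.eventually_all]
          intro i
          by_cases h : i = m
          · exact Filter.Eventually.of_forall fun _ h' => absurd h h'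
          · filter_upwards [isOpen_ne.mem_nhds (fun h' => h (hy h'.symm) : y m ≠ y i)] with t ht _
            exact ht
        filter_upwards [c1, c2] with t ht1 ht2
        rw [← hFy, ← Finset.mul_prod_erase _ _ (Finset.mem_univ m), Function.update_self]
        · congr 1
          refine Finset.prod_congr rfl fun i hi => ?_
          rw [Function.update_of_ne (Finset.ne_of_mem_erase hi), hne i (Finset.ne_of_mem_erase hi)]
        · intro a b hab
          by_cases ha : a = m <;> by_cases hb : b = m
          · rw [ha, hb]
          · subst ha; rw [Function.update_self, Function.update_of_ne hb] at hab
            exact absurd hab (ht2 b hb)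
          · subst hb; rw [Function.update_self, Function.update_of_ne ha] at hab
            exact absurd hab.symm (ht2 a ha)
          · rw [Function.update_of_ne ha, Function.update_of_ne hb] at hab; exact hy hab
        · intro i
          by_cases h : i = m
          · subst h; simpa using ht1
          · rw [Function.update_of_ne h]; exact hy0 i
      have huniq := d1.unique (d2.congr_of_eventuallyEq hev)
      rw [Pi.smul_apply, huniq, Rat.smul_def, ← Finset.mul_prod_erase _ _ (Finset.mem_univ m)]
      have : (k' m : ℂ) ≠ 0 := by have := hk1 m; exact_mod_cast (by omega : k' m ≠ 0)
      push_cast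
      field_simp

/-! ### Rates of convergence -/

/-- `1 + H_N`. -/
noncomputable def hB (N : ℕ) : ℝ := 1 + ∑ i ∈ Finset.range N, 1 / ((i : ℝ) + 1)

theorem hB_succ (N : ℕ) : hB (N + 1) = hB N + 1 / ((N : ℝ) + 1) := by
  simp [hB, Finset.sum_range_succ, add_assoc]

theorem one_le_hB (N : ℕ) : 1 ≤ hB N := by
  have : 0 ≤ ∑ i ∈ Finset.range N, 1 / ((i : ℝ) + 1) := Finset.sum_nonneg fun i _ => by positivity
  rw [hB]; linarith

theorem hB_le_succ (N : ℕ) : hB N ≤ hB (N + 1) := by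
  rw [hB_succ]; have : 0 ≤ 1 / ((N : ℝ) + 1) := by positivity
  linarith

theorem hB_le_log (N : ℕ) : hB N ≤ 2 + Real.log (N + 1) := by
  have h := harmonic_le_one_add_log N
  have e : hB N = 1 + (harmonic N : ℝ) := by
    simp [hB, harmonic]
  have : Real.log N ≤ Real.log (N + 1) := by
    rcases Nat.eq_zero_or_pos N with h | h
    · subst h; simp
    · exact Real.log_le_log (by exact_mod_cast h) (by linarith)
  rw [e]; linarith

theorem hB_pow_le (d : ℕ) : ∃ C : ℝ, 0 ≤ C ∧ ∀ N : ℕ, hB N ^ d ≤ C * √((N : ℝ) + 1) := by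
  have ep : (0 : ℝ) < 1 / (2 * ((d : ℝ) + 1)) := by positivity
  refine ⟨(2 + 2 * ((d : ℝ) + 1)) ^ d, by positivity, fun N => ?_⟩
  have hN : (1 : ℝ) ≤ (N : ℝ) + 1 := by have : (0 : ℝ) ≤ N := by positivity
                                        linarith
  have h1 := Real.log_le_rpow_div (x := (N : ℝ) + 1) (by positivity) ep
  have h2 : (1 : ℝ) ≤ ((N : ℝ) + 1) ^ (1 / (2 * ((d : ℝ) + 1))) := Real.one_le_rpow hN ep.le
  have h3 : hB N ≤ (2 + 2 * ((d : ℝ) + 1)) * ((N : ℝ) + 1) ^ (1 / (2 * ((d : ℝ) + 1))) := by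
    have := hB_le_log N
    rw [div_div_eq_mul_div, div_one] at h1
    nlinarith
  have h0 := one_le_hB N
  calc hB N ^ d ≤ ((2 + 2 * ((d : ℝ) + 1)) * ((N : ℝ) + 1) ^ (1 / (2 * ((d : ℝ) + 1)))) ^ d :=
        pow_le_pow_left₀ (by linarith) h3 d
    _ = (2 + 2 * ((d : ℝ) + 1)) ^ d * ((N : ℝ) + 1) ^ (1 / (2 * ((d : ℝ) + 1)) * d) := by
        rw [mul_pow, ← Real.rpow_mul_natCast (by positivity)]
    _ ≤ _ := by
        rw [Real.sqrt_eq_rpow]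
        refine mul_le_mul_of_nonneg_left ?_ (by positivity)
        refine Real.rpow_le_rpow_of_exponent_le hN ?_
        rw [div_mul_eq_mul_div, div_le_div_iff₀ (by positivity) (by positivity)]
        linarith

theorem growth_step (u v f : ℕ → ℂ) (d : ℕ) (C c : ℝ) (hc : 0 ≤ c) (hC : 0 ≤ C)
    (hu0 : u 0 = 0)
    (hu : ∀ n, u (n + 1) = u n + v n * f n) (hv : ∀ n, ‖v n‖ ≤ C * hB n ^ d)
    (hf : ∀ n, ‖f n‖ ≤ c / ((n : ℝ) + 1)) : ∀ n, ‖u n‖ ≤ (C * c) * hB n ^ (d + 1) := by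
  intro n
  induction n with
  | zero => rw [hu0, norm_zero]; have := one_le_hB 0; positivity
  | succ n ih =>
    have b0 := one_le_hB n
    have b1 := hB_le_succ n
    have b2 : hB n ^ d ≤ hB (n + 1) ^ d := pow_le_pow_left₀ (by linarith) b1 d
    have e : hB (n + 1) ^ (d + 1) = hB (n + 1) ^ d * (hB n + 1 / ((n : ℝ) + 1)) := by
      rw [pow_succ, hB_succ]
    have h1 : ‖v n * f n‖ ≤ C * hB n ^ d * (c / ((n : ℝ) + 1)) := by
      rw [norm_mul]; exact mul_le_mul (hv n) (hf n) (norm_nonneg _) (by positivity)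
    calc ‖u (n + 1)‖ ≤ ‖u n‖ + ‖v n * f n‖ := by rw [hu]; exact norm_add_le _ _
      _ ≤ (C * c) * hB n ^ (d + 1) + C * hB n ^ d * (c / ((n : ℝ) + 1)) := add_le_add ih h1
      _ = (C * c) * (hB n ^ d * (hB n + 1 / ((n : ℝ) + 1))) := by ring
      _ ≤ (C * c) * (hB (n + 1) ^ d * (hB n + 1 / ((n : ℝ) + 1))) := by gcongr
      _ = _ := by rw [e]

theorem sqrt_tele (n : ℕ) : 1 / (((n : ℝ) + 1) * √((n : ℝ) + 1)) ≤
    6 * (1 / √((n : ℝ) + 1) - 1 / √((n : ℝ) + 2)) := by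
  have hn : (0 : ℝ) ≤ n := by positivity
  set a := √((n : ℝ) + 1) with ha
  set b := √((n : ℝ) + 2) with hb
  have ha2 : a ^ 2 = (n : ℝ) + 1 := Real.sq_sqrt (by linarith)
  have hb2 : b ^ 2 = (n : ℝ) + 2 := Real.sq_sqrt (by linarith)
  have ha0 : 0 < a := Real.sqrt_pos.mpr (by linarith)
  have hb0 : 0 < b := Real.sqrt_pos.mpr (by linarith)
  have hb3 : b ≤ 2 * a := by
    by_contra h; push Not at h; nlinarith
  have e : 1 / a - 1 / b = 1 / (a * b * (a + b)) := by
    field_simp; nlinarith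
  rw [e, ← ha2, mul_one_div, div_le_div_iff₀ (by positivity) (by positivity)]
  have : b * (a + b) ≤ 6 * a ^ 2 := by nlinarith
  nlinarith

/-- `u` converges with rate `1/√N`. -/
def Rate (u : ℕ → ℂ) (L : ℂ) : Prop := ∃ C : ℝ, 0 ≤ C ∧ ∀ N : ℕ, ‖u N - L‖ ≤ C / √((N : ℝ) + 1)

theorem tendsto_const_div_sqrt (C : ℝ) :
    Tendsto (fun N : ℕ => C / √((N : ℝ) + 1)) atTop (nhds 0) := by
  refine Tendsto.const_div_atTop ?_ C
  refine Real.tendsto_sqrt_atTop.comp ?_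
  exact tendsto_atTop_add_const_right _ _ tendsto_natCast_atTop_atTop

theorem Rate.tendsto {u : ℕ → ℂ} {L : ℂ} (h : Rate u L) : Tendsto u atTop (nhds L) := by
  obtain ⟨C, _, h⟩ := h
  rw [tendsto_iff_norm_sub_tendsto_zero]
  exact squeeze_zero (fun _ => norm_nonneg _) h (tendsto_const_div_sqrt C)

theorem rate_of_summable (u w : ℕ → ℂ) (C : ℝ) (hC : 0 ≤ C) (hu : ∀ n, u (n + 1) = u n + w n)
    (hw : ∀ n : ℕ, ‖w n‖ ≤ C * (1 / (((n : ℝ) + 1) * √((n : ℝ) + 1)))) : ∃ L, Rate u L := by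
  have key : ∀ N m : ℕ, ‖u (N + m) - u N‖ ≤
      6 * C * (1 / √((N : ℝ) + 1) - 1 / √(((N + m : ℕ) : ℝ) + 1)) := by
    intro N m
    induction m with
    | zero => simp
    | succ m ih =>
      have h1 := (hw (N + m)).trans (mul_le_mul_of_nonneg_left (sqrt_tele (N + m)) hC)
      have h2 : u (N + (m + 1)) - u N = (u (N + m) - u N) + w (N + m) := by
        rw [← add_assoc, hu]; ring
      have h3 := norm_add_le (u (N + m) - u N) (w (N + m))
      rw [h2]
      have e : (((N + (m + 1) : ℕ)) : ℝ) + 1 = (((N + m : ℕ)) : ℝ) + 2 := by push_cast; ring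
      rw [e]
      linarith
  have key2 : ∀ N M : ℕ, N ≤ M → ‖u M - u N‖ ≤ 6 * C / √((N : ℝ) + 1) := by
    intro N M h
    obtain ⟨m, rfl⟩ := Nat.exists_eq_add_of_le h
    refine (key N m).trans ?_
    rw [← mul_one_div (6 * C)]
    refine mul_le_mul_of_nonneg_left ?_ (by positivity)
    have : 0 ≤ 1 / √(((N + m : ℕ) : ℝ) + 1) := by positivity
    linarith
  have hcs : CauchySeq u := by
    refine cauchySeq_of_le_tendsto_0' (fun N : ℕ => 6 * C / √((N : ℝ) + 1)) ?_
      (tendsto_const_div_sqrt _)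
    intro N M h
    rw [dist_comm, dist_eq_norm]; exact key2 N M h
  obtain ⟨L, hL⟩ := cauchySeq_tendsto_of_complete hcs
  refine ⟨L, 6 * C, by positivity, fun N => ?_⟩
  have ht : Tendsto (fun M => ‖u M - u N‖) atTop (nhds ‖L - u N‖) := (hL.sub_const _).norm
  rw [norm_sub_rev]
  refine le_of_tendsto ht ?_
  filter_upwards [eventually_ge_atTop N] with M hM using key2 N M hM

theorem Rate.add {u v : ℕ → ℂ} {L : ℂ} (h : Rate u L) (C : ℝ) (hC : 0 ≤ C)
    (hv : ∀ N : ℕ, ‖v N - u N‖ ≤ C / √((N : ℝ) + 1)) : Rate v L := by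
  obtain ⟨D, hD, h⟩ := h
  refine ⟨C + D, by positivity, fun N => ?_⟩
  have e : v N - L = (v N - u N) + (u N - L) := by ring
  rw [e, add_div]
  exact (norm_add_le _ _).trans (add_le_add (hv N) (h N))

theorem nest_snoc_succ (fs : List (ℤ → ℂ)) (f : ℤ → ℂ) (N : ℕ) :
    nest (fs ++ [f]) 0 ((N + 1 : ℕ) : ℤ) = nest (fs ++ [f]) 0 (N : ℤ) +
      nest fs 0 (N : ℤ) * f ((N : ℤ) + 1) := by
  rw [nest_snoc, nest_snoc,
    sum_Ioc_split _ (by omega : (0 : ℤ) ≤ N) (by push_cast; omega : (N : ℤ) ≤ ((N + 1 : ℕ) : ℤ))]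
  congr 1
  have : Finset.Ioc (N : ℤ) ((N + 1 : ℕ) : ℤ) = {(N : ℤ) + 1} := by
    ext m; simp only [Finset.mem_Ioc, Finset.mem_singleton]; push_cast; omega
  rw [this, Finset.sum_singleton]; congr 2; ring

theorem nest_zero_snoc (fs : List (ℤ → ℂ)) (f : ℤ → ℂ) : nest (fs ++ [f]) 0 ((0 : ℕ) : ℤ) = 0 := by
  rw [nest_snoc]; simp

theorem IsRootOfUnity.norm {z : ℂ} (h : IsRootOfUnity z) : ‖z‖ = 1 := by
  obtain ⟨N, hN, h⟩ := h
  exact Complex.norm_eq_one_of_pow_eq_one h (by omega)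

theorem IsRootOfUnity.ne_zero {z : ℂ} (h : IsRootOfUnity z) : z ≠ 0 := by
  rintro rfl; have := h.norm; simp at this

theorem norm_shift {β : ℝ} (hβ : 1 / 2 ≤ β) (n : ℕ) : ((n : ℝ) + 1) / 2 ≤ ‖(n : ℂ) + (β : ℂ)‖ := by
  have hn : (0 : ℝ) ≤ n := by positivity
  have : (n : ℂ) + (β : ℂ) = ((n + β : ℝ) : ℂ) := by push_cast; ring
  rw [this, Complex.norm_real, Real.norm_of_nonneg (by linarith)]; linarith

theorem fz_succ (β : ℝ) (p : ℕ × ℂ) (n : ℕ) :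
    fz β p ((n : ℤ) + 1) = p.2 ^ (n + 1) / ((n : ℂ) + β) ^ p.1 := by
  have h1 : (((n : ℤ) + 1 : ℤ) : ℂ) + (β : ℂ) - 1 = (n : ℂ) + β := by push_cast; ring
  rw [fz, h1]; norm_cast

theorem norm_fz {β : ℝ} (hβ : 1 / 2 ≤ β) (p : ℕ × ℂ) (hx : ‖p.2‖ = 1) (n : ℕ) (j : ℕ)
    (hj : j ≤ p.1) :
    ‖fz β p ((n : ℤ) + 1)‖ ≤ 2 ^ p.1 / ((n : ℝ) + 1) ^ j := by
  have hn : (1 : ℝ) ≤ (n : ℝ) + 1 := by have : (0 : ℝ) ≤ n := by positivity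
                                        linarith
  rw [fz_succ, norm_div, norm_pow, hx, one_pow, norm_pow]
  have h1 := norm_shift hβ n
  have h2 : (((n : ℝ) + 1) / 2) ^ p.1 ≤ ‖(n : ℂ) + (β : ℂ)‖ ^ p.1 :=
    pow_le_pow_left₀ (by positivity) h1 _
  have h3 : ((n : ℝ) + 1) ^ j ≤ ((n : ℝ) + 1) ^ p.1 := pow_le_pow_right₀ hn hj
  calc 1 / ‖(n : ℂ) + (β : ℂ)‖ ^ p.1 ≤ 1 / (((n : ℝ) + 1) / 2) ^ p.1 :=
        one_div_le_one_div_of_le (by positivity) h2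
    _ = 2 ^ p.1 / ((n : ℝ) + 1) ^ p.1 := by rw [div_pow, one_div_div]
    _ ≤ _ := by gcongr

theorem growth {β : ℝ} (hβ : 1 / 2 ≤ β) (K : List (ℕ × ℂ))
    (hK : ∀ p ∈ K, 0 < p.1 ∧ IsRootOfUnity p.2) :
    ∃ (d : ℕ) (C : ℝ), 0 ≤ C ∧ (∀ N : ℕ, ‖nest (K.map (fz β)) 0 N‖ ≤ C * hB N ^ d) ∧
      ∀ N : ℕ, ‖nest (K.map (fz β)) 0 ((N + 1 : ℕ) : ℤ) - nest (K.map (fz β)) 0 N‖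
        ≤ C * hB N ^ d / ((N : ℝ) + 1) := by
  induction K using List.reverseRecOn with
  | nil => exact ⟨0, 1, by norm_num, fun N => by simp [nest_nil], fun N => by
      simp only [List.map_nil, nest_nil, sub_self, norm_zero]; positivity⟩
  | append_singleton K p ih =>
    obtain ⟨d, C, hC, h1, -⟩ := ih fun q hq => hK q (by simp [hq])
    have hp := hK p (by simp)
    have hf : ∀ n : ℕ, ‖fz β p ((n : ℤ) + 1)‖ ≤ 2 ^ p.1 / ((n : ℝ) + 1) := fun n => by
      have := norm_fz hβ p hp.2.norm n 1 hp.1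
      rwa [pow_one] at this
    simp only [List.map_append, List.map_cons, List.map_nil]
    refine ⟨d + 1, C * 2 ^ p.1, by positivity, ?_, ?_⟩
    · exact growth_step _ (fun N => nest (K.map (fz β)) 0 N) (fun n => fz β p ((n : ℤ) + 1)) d C
        (2 ^ p.1) (by positivity) hC (nest_zero_snoc _ _) (fun n => nest_snoc_succ _ _ n) h1 hf
    · intro N
      rw [nest_snoc_succ, add_sub_cancel_left, norm_mul]
      have b0 := one_le_hB N
      have h3 := mul_le_mul (h1 N) (hf N) (norm_nonneg _) (by positivity)
      refine h3.trans ?_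
      rw [mul_div_assoc', mul_right_comm]
      gcongr
      omega

theorem exists_rate {β : ℝ} (hβ : 1 / 2 ≤ β) (K : List (ℕ × ℂ))
    (hK : ∀ p ∈ K, 0 < p.1 ∧ IsRootOfUnity p.2)
    (hl : ∀ p ∈ K.getLast?, ¬(p.1 = 1 ∧ p.2 = 1)) :
    ∃ L, Rate (fun N : ℕ => nest (K.map (fz β)) 0 N) L := by
  induction K using List.reverseRecOn with
  | nil => exact ⟨1, 0, le_rfl, fun N => by simp [nest_nil]⟩
  | append_singleton K p ih =>
    clear ih
    have hp := hK p (by simp)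
    have hp1 : ¬(p.1 = 1 ∧ p.2 = 1) := hl p (by simp)
    obtain ⟨d, C, hC, h1, h2⟩ := growth hβ K fun q hq => hK q (by simp [hq])
    obtain ⟨D, hD, hB⟩ := hB_pow_le d
    simp only [List.map_append, List.map_cons, List.map_nil]
    have hsq : ∀ n : ℕ, √((n : ℝ) + 1) * √((n : ℝ) + 1) = (n : ℝ) + 1 := fun n =>
      Real.mul_self_sqrt (by positivity)
    have hsp : ∀ n : ℕ, 0 < √((n : ℝ) + 1) := fun n => Real.sqrt_pos.mpr (by positivity)
    by_cases hk : 2 ≤ p.1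
    · refine rate_of_summable _ (fun N => nest (K.map (fz β)) 0 (N : ℤ) * fz β p ((N : ℤ) + 1))
        (C * D * 2 ^ p.1) (by positivity) (fun n => nest_snoc_succ _ _ n) fun n => ?_
      rw [norm_mul]
      have h3 : ‖nest (K.map (fz β)) 0 (n : ℤ)‖ ≤ C * (D * √((n : ℝ) + 1)) :=
        (h1 n).trans (mul_le_mul_of_nonneg_left (hB n) hC)
      refine (mul_le_mul h3 (norm_fz hβ p hp.2.norm n 2 hk) (norm_nonneg _)
        (by positivity)).trans (le_of_eq ?_)
      have a := hsq n
      have b := hsp n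
      set s := √((n : ℝ) + 1)
      rw [← a]
      field_simp
    · have hk1 : p.1 = 1 := by omega
      have hx : p.2 ≠ 1 := fun h => hp1 ⟨hk1, h⟩
      have hx' : p.2 - 1 ≠ 0 := sub_ne_zero.mpr hx
      have hc : 0 < ‖p.2 - 1‖ := norm_pos_iff.mpr hx'
      set x := p.2 with hxdef
      have hxn : ‖x‖ = 1 := hp.2.norm
      set v : ℕ → ℂ := fun n => nest (K.map (fz β)) 0 (n : ℤ) with hv
      set u : ℕ → ℂ := fun n => nest (K.map (fz β) ++ [fz β p]) 0 (n : ℤ) with hu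
      have hne : ∀ n : ℕ, (n : ℂ) + (β : ℂ) ≠ 0 := fun n => by
        have := norm_shift hβ n
        have h0 : 0 < ((n : ℝ) + 1) / 2 := by positivity
        exact norm_pos_iff.mp (h0.trans_le this)
      have hw : ∀ n : ℕ, ‖((n : ℂ) + (β : ℂ))⁻¹‖ ≤ 2 / ((n : ℝ) + 1) := fun n => by
        rw [norm_inv, ← inv_div]
        exact inv_anti₀ (by positivity) (norm_shift hβ n)
      set a : ℕ → ℂ := fun n => v n * ((n : ℂ) + (β : ℂ))⁻¹ with ha
      have hus : ∀ n, u (n + 1) = u n + x ^ (n + 1) * a n := fun n => by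
        have := nest_snoc_succ (K.map (fz β)) (fz β p) n
        rw [fz_succ, hk1, pow_one] at this
        simp only [hu, this, ha, hv]; ring
      have h3 : ∀ n : ℕ, ‖v n‖ ≤ C * (D * √((n : ℝ) + 1)) := fun n =>
        (h1 n).trans (mul_le_mul_of_nonneg_left (hB n) hC)
      have h4 : ∀ n : ℕ, ‖v (n + 1) - v n‖ ≤ C * (D * √((n : ℝ) + 1)) / ((n : ℝ) + 1) := fun n =>
        (h2 n).trans (by have := hB n; gcongr)
      have ha1 : ∀ n : ℕ, ‖a n‖ ≤ 2 * C * D / √((n : ℝ) + 1) := fun n => by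
        simp only [ha]
        rw [norm_mul]
        refine (mul_le_mul (h3 n) (hw n) (norm_nonneg _) (by positivity)).trans (le_of_eq ?_)
        have a := hsq n
        have b := hsp n
        set s := √((n : ℝ) + 1)
        rw [← a]
        field_simp
      have ha2 : ∀ n : ℕ, ‖a n - a (n + 1)‖ ≤
          6 * C * D * (1 / (((n : ℝ) + 1) * √((n : ℝ) + 1))) := fun n => by
        have e : a n - a (n + 1) = v n * (((n : ℂ) + (β : ℂ))⁻¹ * (((n + 1 : ℕ) : ℂ) + (β : ℂ))⁻¹)
            - (v (n + 1) - v n) * (((n + 1 : ℕ) : ℂ) + (β : ℂ))⁻¹ := by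
          have e1 := hne n
          have e2 := hne (n + 1)
          simp only [ha]
          field_simp
          push_cast
          ring
        have w1 : ‖(((n + 1 : ℕ) : ℂ) + (β : ℂ))⁻¹‖ ≤ 2 / ((n : ℝ) + 1) := by
          refine (hw (n + 1)).trans ?_
          push_cast
          gcongr
          linarith
        have t1 : ‖v n * (((n : ℂ) + (β : ℂ))⁻¹ * (((n + 1 : ℕ) : ℂ) + (β : ℂ))⁻¹)‖ ≤
            C * (D * √((n : ℝ) + 1)) * (2 / ((n : ℝ) + 1) * (2 / ((n : ℝ) + 1))) := by
          rw [norm_mul, norm_mul]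
          exact mul_le_mul (h3 n) (mul_le_mul (hw n) w1 (norm_nonneg _) (by positivity))
            (by positivity) (by positivity)
        have t2 : ‖(v (n + 1) - v n) * (((n + 1 : ℕ) : ℂ) + (β : ℂ))⁻¹‖ ≤
            C * (D * √((n : ℝ) + 1)) / ((n : ℝ) + 1) * (2 / ((n : ℝ) + 1)) := by
          rw [norm_mul]
          exact mul_le_mul (h4 n) w1 (norm_nonneg _) (by positivity)
        rw [e]
        refine (norm_sub_le _ _).trans ((add_le_add t1 t2).trans (le_of_eq ?_))
        have a := hsq n
        have b := hsp n
        set s := √((n : ℝ) + 1)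
        rw [← a]
        field_simp
        ring
      obtain ⟨L, hL⟩ := rate_of_summable (fun n => u n - x ^ (n + 1) / (x - 1) * a n)
        (fun n => x ^ (n + 2) / (x - 1) * (a n - a (n + 1))) (6 * C * D / ‖x - 1‖) (by positivity)
        (fun n => by
          rw [hus]; field_simp; ring)
        (fun n => by
          rw [norm_mul, norm_div, norm_pow, hxn, one_pow, div_mul_eq_mul_div, div_mul_eq_mul_div,
            one_mul]
          gcongr
          exact ha2 n)
      refine ⟨L, hL.add (2 * C * D / ‖x - 1‖) (by positivity) fun n => ?_⟩
      rw [sub_sub_cancel, norm_mul, norm_div, norm_pow, hxn, one_pow, div_mul_eq_mul_div, one_mul,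
        div_right_comm]
      gcongr
      exact ha1 n

theorem rate_lim {β : ℝ} (hβ : 1 / 2 ≤ β) (K : List (ℕ × ℂ))
    (hK : ∀ p ∈ K, 0 < p.1 ∧ IsRootOfUnity p.2)
    (hl : ∀ p ∈ K.getLast?, ¬(p.1 = 1 ∧ p.2 = 1)) :
    Rate (fun N : ℕ => nest (K.map (fz β)) 0 N) (cmhz (K.map fun p => (p.1, p.2, (β : ℂ)))) := by
  obtain ⟨L, hL⟩ := exists_rate hβ K hK hl
  have h : cmhz (K.map fun p => (p.1, p.2, (β : ℂ))) = L := by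
    have e : cmhzP (K.map fun p => (p.1, p.2, (β : ℂ))) =
      fun N : ℕ => nest (K.map (fz β)) 0 N := funext fun N => cmhzP_eq K β N
    rw [cmhz, e]
    exact hL.tendsto.limUnder_eq
  rw [h]; exact hL

theorem rate_t (K : List (ℕ × ℂ)) (hK : ∀ p ∈ K, 0 < p.1 ∧ IsRootOfUnity p.2)
    (hl : ∀ p ∈ K.getLast?, ¬(p.1 = 1 ∧ p.2 = 1)) :
    Rate (fun N : ℕ => nest (K.map (fz (1 / 2))) 0 N) (tval K) := by
  have := rate_lim (le_refl (1 / 2 : ℝ)) K hK hl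
  push_cast at this
  exact this

theorem rate_z (K : List (ℕ × ℂ)) (hK : ∀ p ∈ K, 0 < p.1 ∧ IsRootOfUnity p.2)
    (hl : ∀ p ∈ K.getLast?, ¬(p.1 = 1 ∧ p.2 = 1)) :
    Rate (fun N : ℕ => nest (K.map (fz 1)) 0 N) (cmzv K) := by
  have := rate_lim (by norm_num : (1 / 2 : ℝ) ≤ 1) K hK hl
  push_cast at this
  exact this

theorem sum_Ioc_sym (N : ℕ) (f : ℤ → ℂ) :
    ∑ n ∈ Finset.Ioc (-(N : ℤ)) N, f n
      = ∑ i ∈ Finset.range N, (f ((i : ℤ) + 1) + f (-(i : ℤ))) := by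
  induction N with
  | zero => simp
  | succ N ih =>
    rw [Finset.sum_range_succ, ← ih,
      sum_Ioc_split (c := -(N : ℤ)) _ (by push_cast; omega) (by push_cast; omega),
      sum_Ioc_split (a := -(N : ℤ)) (c := (N : ℤ)) _ (by push_cast; omega) (by push_cast; omega)]
    have h1 : Finset.Ioc (N : ℤ) ((N + 1 : ℕ) : ℤ) = {(N : ℤ) + 1} := by
      ext m; simp only [Finset.mem_Ioc, Finset.mem_singleton]; push_cast; omega
    have h2 : Finset.Ioc (-((N + 1 : ℕ) : ℤ)) (-(N : ℤ)) = {-(N : ℤ)} := by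
      ext m; simp only [Finset.mem_Ioc, Finset.mem_singleton]; push_cast; omega
    rw [h1, h2, Finset.sum_singleton, Finset.sum_singleton]; ring

theorem tendsto_hB : Tendsto (fun N : ℕ => hB N / √((N : ℝ) + 1)) atTop (nhds 0) := by
  obtain ⟨C, hC, h⟩ := hB_pow_le 2
  have h1 : Tendsto (fun N : ℕ => (hB N / √((N : ℝ) + 1)) ^ 2) atTop (nhds 0) := by
    refine squeeze_zero (fun _ => by positivity) (fun N => ?_) (tendsto_const_div_sqrt C)
    have hs : 0 < √((N : ℝ) + 1) := Real.sqrt_pos.mpr (by positivity)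
    rw [div_pow, div_le_div_iff₀ (by positivity) hs]
    have := mul_le_mul_of_nonneg_right (h N) hs.le
    nlinarith
  have h2 := (Real.continuous_sqrt.tendsto 0).comp h1
  rw [Real.sqrt_zero] at h2
  refine h2.congr fun N => ?_
  have := one_le_hB N
  exact Real.sqrt_sq (by positivity)

theorem err_sum (N : ℕ) : ∑ i ∈ Finset.range N,
    1 / ((i : ℝ) + 1) * (1 / √(((N - 1 - i : ℕ) : ℝ) + 1)) ≤ 2 * (hB N / √((N : ℝ) + 1)) := by
  have hs : 0 < √((N : ℝ) + 1) := Real.sqrt_pos.mpr (by positivity)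
  have key : ∀ i ∈ Finset.range N, 1 / ((i : ℝ) + 1) * (1 / √(((N - 1 - i : ℕ) : ℝ) + 1)) ≤
      1 / √((N : ℝ) + 1) * (1 / ((i : ℝ) + 1) + 1 / (((N - 1 - i : ℕ) : ℝ) + 1)) := by
    intro i hi
    have hi := Finset.mem_range.mp hi
    obtain ⟨m, rfl⟩ : ∃ m, N = m + i + 1 := ⟨N - 1 - i, by omega⟩
    have hm : m + i + 1 - 1 - i = m := by omega
    rw [hm]
    have e1 : (((m + i + 1 : ℕ) : ℝ) + 1) = ((m : ℝ) + 1) + ((i : ℝ) + 1) := by push_cast; ring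
    rw [e1] at hs ⊢
    have a2 : √((m : ℝ) + 1) ^ 2 = (m : ℝ) + 1 := Real.sq_sqrt (by positivity)
    have b2 : √((m : ℝ) + 1 + ((i : ℝ) + 1)) ^ 2 = (m : ℝ) + 1 + ((i : ℝ) + 1) :=
      Real.sq_sqrt (by positivity)
    have hab : √((m : ℝ) + 1) ≤ √((m : ℝ) + 1 + ((i : ℝ) + 1)) :=
      Real.sqrt_le_sqrt (by have : (0 : ℝ) ≤ i := by positivity
                            linarith)
    have ha : 0 < √((m : ℝ) + 1) := Real.sqrt_pos.mpr (by positivity)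
    set a := √((m : ℝ) + 1)
    set b := √((m : ℝ) + 1 + ((i : ℝ) + 1))
    have hi0 : (0 : ℝ) < (i : ℝ) + 1 := by positivity
    have e2 : 1 / b * (1 / ((i : ℝ) + 1) + 1 / ((m : ℝ) + 1)) = b / (((i : ℝ) + 1) * a ^ 2) := by
      rw [← a2]
      rw [← a2] at b2
      field_simp
      rw [b2]
    rw [e2, div_mul_div_comm, one_mul, div_le_div_iff₀ (by positivity) (by positivity)]
    have : 0 < ((i : ℝ) + 1) * a := by positivity
    nlinarith
  refine (Finset.sum_le_sum key).trans ?_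
  rw [← Finset.mul_sum, Finset.sum_add_distrib,
    Finset.sum_range_reflect (fun i : ℕ => 1 / ((i : ℝ) + 1)) N]
  have : ∑ i ∈ Finset.range N, 1 / ((i : ℝ) + 1) ≤ hB N := by rw [hB]; linarith
  have h2 : (∑ i ∈ Finset.range N, 1 / ((i : ℝ) + 1)) + ∑ i ∈ Finset.range N, 1 / ((i : ℝ) + 1)
      ≤ 2 * hB N := by linarith
  calc _ ≤ 1 / √((N : ℝ) + 1) * (2 * hB N) := by gcongr
    _ = _ := by ring

theorem Rate.bdd {u : ℕ → ℂ} {L : ℂ} (h : Rate u L) : ∃ C : ℝ, 0 ≤ C ∧ ∀ N, ‖u N‖ ≤ C := by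
  obtain ⟨C, hC, h⟩ := h
  refine ⟨C + ‖L‖, by positivity, fun N => ?_⟩
  have e : u N = (u N - L) + L := by ring
  have h1 : (1 : ℝ) ≤ √((N : ℝ) + 1) := by
    rw [Real.one_le_sqrt]; have : (0 : ℝ) ≤ N := by positivity
    linarith
  have h2 : C / √((N : ℝ) + 1) ≤ C := div_le_self hC h1
  rw [e]
  refine (norm_add_le _ _).trans ?_
  have := h N
  linarith

theorem conv_lemma (P Q : ℕ → ℂ) (p q : ℂ) (hP : Rate P p) (hQ : Rate Q q) (g : ℤ → ℂ) (c : ℝ)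
    (hc : 0 ≤ c) (hg1 : ∀ i : ℕ, ‖g ((i : ℤ) + 1)‖ ≤ c / ((i : ℝ) + 1))
    (hg2 : ∀ i : ℕ, ‖g (-(i : ℤ))‖ ≤ c / ((i : ℝ) + 1)) :
    Tendsto (fun N : ℕ => ∑ n ∈ Finset.Ioc (-(N : ℤ)) N,
      g n * P ((N : ℤ) + n - 1).toNat * Q ((N : ℤ) - n).toNat
        - p * q * ∑ n ∈ Finset.Ioc (-(N : ℤ)) N, g n) atTop (nhds 0) := by
  obtain ⟨M, hM, hQb⟩ := hQ.bdd
  obtain ⟨C1, hC1, h1⟩ := hP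
  obtain ⟨C2, hC2, h2⟩ := hQ
  set D := C1 * M + ‖p‖ * C2 with hD
  have hD0 : 0 ≤ D := by positivity
  have hPQ : ∀ a b s : ℕ, s ≤ a → s ≤ b → ‖P a * Q b - p * q‖ ≤ D * (1 / √((s : ℝ) + 1)) := by
    intro a b s ha hb
    have e : P a * Q b - p * q = (P a - p) * Q b + p * (Q b - q) := by ring
    have hs : 0 < √((s : ℝ) + 1) := Real.sqrt_pos.mpr (by positivity)
    have ma : C1 / √((a : ℝ) + 1) ≤ C1 * (1 / √((s : ℝ) + 1)) := by
      rw [mul_one_div]; gcongr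
    have mb : C2 / √((b : ℝ) + 1) ≤ C2 * (1 / √((s : ℝ) + 1)) := by
      rw [mul_one_div]; gcongr
    rw [e]
    refine (norm_add_le _ _).trans ?_
    rw [norm_mul, norm_mul]
    have t1 := mul_le_mul ((h1 a).trans ma) (hQb b) (norm_nonneg _) (by positivity)
    have t2 := mul_le_mul_of_nonneg_left ((h2 b).trans mb) (norm_nonneg p)
    rw [hD]
    nlinarith
  have hlim : Tendsto (fun N : ℕ => (2 * c * D) * (2 * (hB N / √((N : ℝ) + 1)))) atTop (nhds 0) := by
    have := (tendsto_hB.const_mul 2).const_mul (2 * c * D)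
    simpa using this
  refine squeeze_zero_norm (fun N => ?_) hlim
  rw [Finset.mul_sum, ← Finset.sum_sub_distrib, sum_Ioc_sym]
  refine (norm_sum_le _ _).trans ?_
  refine le_trans ?_ (mul_le_mul_of_nonneg_left (err_sum N) (by positivity))
  rw [Finset.mul_sum]
  refine Finset.sum_le_sum fun i hi => ?_
  have hi := Finset.mem_range.mp hi
  have e : ∀ n : ℤ, g n * P ((N : ℤ) + n - 1).toNat * Q ((N : ℤ) - n).toNat - p * q * g n
      = g n * (P ((N : ℤ) + n - 1).toNat * Q ((N : ℤ) - n).toNat - p * q) := fun n => by ring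
  rw [e, e]
  refine (norm_add_le _ _).trans ?_
  rw [norm_mul, norm_mul]
  have t1 := mul_le_mul (hg1 i) (hPQ ((N : ℤ) + ((i : ℤ) + 1) - 1).toNat
    ((N : ℤ) - ((i : ℤ) + 1)).toNat (N - 1 - i) (by omega) (by omega)) (norm_nonneg _)
    (by positivity)
  have t2 := mul_le_mul (hg2 i) (hPQ ((N : ℤ) + (-(i : ℤ)) - 1).toNat
    ((N : ℤ) - (-(i : ℤ))).toNat (N - 1 - i) (by omega) (by omega)) (norm_nonneg _)
    (by positivity)
  refine (add_le_add t1 t2).trans (le_of_eq ?_)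
  ring

/-! ### Reflection -/

/-- Reverse the list and invert the roots of unity. -/
noncomputable def invL (K : List (ℕ × ℂ)) : List (ℕ × ℂ) :=
  K.reverse.map fun p => (p.1, p.2⁻¹)

theorem fz_half_reflect (p : ℕ × ℂ) (hp : p.2 ≠ 0) (n : ℤ) :
    fz (1 / 2) p (1 - n) = ((-1) ^ p.1 * p.2) * fz (1 / 2) (p.1, p.2⁻¹) n := by
  have h1 : (((1 - n : ℤ) : ℂ) + 1 / 2 - 1) = -((n : ℂ) + 1 / 2 - 1) := by push_cast; ring
  simp only [fz]
  rw [h1, zpow_sub₀ hp, zpow_one, inv_zpow, neg_pow]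
  have : ((-1 : ℂ) ^ p.1)⁻¹ = (-1) ^ p.1 := by rw [← inv_pow]; norm_num
  rw [div_eq_mul_inv, mul_inv, this]
  ring

theorem fz_one_reflect (p : ℕ × ℂ) (n : ℤ) :
    fz 1 p (0 - n) = ((-1) ^ p.1) * fz 1 (p.1, p.2⁻¹) n := by
  have h1 : (((0 - n : ℤ) : ℂ) + 1 - 1) = -((n : ℂ) + 1 - 1) := by push_cast; ring
  simp only [fz]
  rw [h1, zero_sub, zpow_neg, inv_zpow, neg_pow]
  have : ((-1 : ℂ) ^ p.1)⁻¹ = (-1) ^ p.1 := by rw [← inv_pow]; norm_num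
  rw [div_eq_mul_inv, mul_inv, this]
  ring

theorem nest_half_reflect (K : List (ℕ × ℂ)) (hK : ∀ p ∈ K, p.2 ≠ 0) (N : ℤ) :
    nest (K.map (fz (1 / 2))) (-N) 0 = (K.map fun p => (-1) ^ p.1 * p.2).prod *
      nest ((invL K).map (fz (1 / 2))) 0 N := by
  rw [nest_reflect K _ 1]
  have h : (K.reverse.map fun p n => fz (1 / 2) p (1 - n)) = K.reverse.map fun p n =>
      ((-1) ^ p.1 * p.2) * (fun p n => fz (1 / 2) (p.1, p.2⁻¹) n) p n := by
    refine List.map_congr_left fun p hp => ?_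
    funext n
    exact fz_half_reflect p (hK p (List.mem_reverse.mp hp)) n
  rw [h, nest_scale, ((List.reverse_perm K).map _).prod_eq, invL, List.map_map]
  congr 2; ring

theorem nest_one_reflect (K : List (ℕ × ℂ)) (M : ℤ) :
    nest (K.map (fz 1)) (-M) (-1) = (K.map fun p => (-1) ^ p.1).prod *
      nest ((invL K).map (fz 1)) 0 (M - 1) := by
  rw [nest_reflect K _ 0]
  have h : (K.reverse.map fun p n => fz 1 p (0 - n)) = K.reverse.map fun p n =>
      ((-1) ^ p.1) * (fun p n => fz 1 (p.1, p.2⁻¹) n) p n := by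
    refine List.map_congr_left fun p hp => ?_
    funext n
    exact fz_one_reflect p n
  rw [h, nest_scale, ((List.reverse_perm K).map _).prod_eq, invL, List.map_map]
  congr 2; ring

theorem pivot (r : ℕ) (j : Fin r) (l : ℕ) (e : Fin r → ℕ) (x : Fin r → ℂ) (hx : ∀ i, x i ≠ 0)
    (a b : ℤ) :
    ∑ n ∈ tup r a b, (∏ i, x i ^ (n i)) * pfG j l e (fun i => (n i : ℂ) + 1 / 2 - 1) =
    ∑ p ∈ Finset.Ioc a b, fz (1 / 2) (l, ∏ i, x i) p *
      nest (((List.ofFn fun i => (e i, x i)).take j).map (fz 1)) (a - p) (-1) *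
      nest (((List.ofFn fun i => (e i, x i)).drop (j + 1)).map (fz 1)) 0 (b - p) := by
  have e1 : ∀ n ∈ tup r a b, (∏ i, x i ^ (n i)) * pfG j l e (fun i => (n i : ℂ) + 1 / 2 - 1) =
      ∑ p ∈ Finset.Ioc a b, ∏ i, (if i = j then fun m => if m = p then
        fz (1 / 2) (l, ∏ i, x i) p else 0 else fun m => fz 1 (e i, x i) (m - p)) (n i) := by
    intro n hn
    have hn := (mem_tup.mp hn).1 j
    rw [Finset.sum_eq_single (n j)]
    · conv_rhs => rw [← Finset.mul_prod_erase _ _ (Finset.mem_univ j), if_pos rfl, if_pos rfl]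
      have h2 : ∏ i ∈ Finset.univ.erase j, (if i = j then fun m => if m = n j then
          fz (1 / 2) (l, ∏ i, x i) (n j) else 0 else fun m => fz 1 (e i, x i) (m - n j)) (n i)
          = (∏ i ∈ Finset.univ.erase j, (x i ^ (n i) * (x i ^ (n j))⁻¹)) *
            ∏ i ∈ Finset.univ.erase j,
            (((n i : ℂ) + 1 / 2 - 1 - ((n j : ℂ) + 1 / 2 - 1)) ^ (e i))⁻¹ := by
        rw [← Finset.prod_mul_distrib]
        refine Finset.prod_congr rfl fun i hi => ?_
        rw [if_neg (Finset.ne_of_mem_erase hi)]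
        simp only [fz]
        rw [zpow_sub₀ (hx i), div_eq_mul_inv, div_eq_mul_inv]
        congr 3
        push_cast; ring
      rw [h2, Finset.prod_mul_distrib, pfG]
      simp only [fz]
      rw [← Finset.prod_zpow, ← Finset.mul_prod_erase _ (fun i => x i ^ n i) (Finset.mem_univ j),
        ← Finset.mul_prod_erase _ (fun i => x i ^ n j) (Finset.mem_univ j),
        Finset.prod_inv_distrib (fun i => x i ^ n j)]
      have h3 : ∏ i ∈ Finset.univ.erase j, x i ^ (n j) ≠ 0 :=
        Finset.prod_ne_zero_iff.mpr fun i _ => zpow_ne_zero _ (hx i)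
      generalize ∏ i ∈ Finset.univ.erase j, x i ^ (n j) = A at h3 ⊢
      generalize ∏ i ∈ Finset.univ.erase j, x i ^ (n i) = B
      generalize ∏ i ∈ Finset.univ.erase j,
        (((n i : ℂ) + 1 / 2 - 1 - ((n j : ℂ) + 1 / 2 - 1)) ^ (e i))⁻¹ = E
      rw [div_eq_mul_inv]
      generalize (((n j : ℂ) + 1 / 2 - 1) ^ l)⁻¹ = F
      field_simp
    · intro p _ hp
      refine Finset.prod_eq_zero (Finset.mem_univ j) ?_
      rw [if_pos rfl, if_neg (Ne.symm hp)]
    · intro h; exact absurd (Finset.mem_Ioc.mpr hn) h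
  rw [Finset.sum_congr rfl e1, Finset.sum_comm]
  refine Finset.sum_congr rfl fun p hp => ?_
  rw [nest_ofFn]
  have h4 : (List.ofFn fun i : Fin r => (if i = j then fun m => if m = p then
        fz (1 / 2) (l, ∏ i, x i) p else 0 else fun m => fz 1 (e i, x i) (m - p))) =
      ((List.ofFn fun i => (e i, x i)).take j).map (fun q m => fz 1 q (m - p)) ++
        (fun m => if m = p then fz (1 / 2) (l, ∏ i, x i) p else 0) ::
        ((List.ofFn fun i => (e i, x i)).drop (j + 1)).map (fun q m => fz 1 q (m - p)) := by
    have hj := j.2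
    apply List.ext_getElem
    · simp; omega
    · intro i h1 h2
      rw [List.getElem_append]
      split_ifs with h
      · simp only [List.length_map, List.length_take, List.length_ofFn] at h
        have : i ≠ j := by omega
        simp [Fin.ext_iff, this]
      · simp only [List.length_map, List.length_take, List.length_ofFn] at h
        have hm : min (j : ℕ) r = j := by omega
        simp only [List.length_map, List.length_take, List.length_ofFn, hm]
        by_cases hij : i = j
        · simp [hij, Fin.ext_iff]
        · obtain ⟨d, rfl⟩ : ∃ d, i = j + (d + 1) := ⟨i - j - 1, by omega⟩
          simp only [Nat.add_sub_cancel_left, List.getElem_cons_succ]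
          simp [Fin.ext_iff, add_assoc, add_comm 1 d]
  rw [h4, nest_append, Finset.sum_eq_single p]
  · have hsh : ∀ (K : List (ℕ × ℂ)) (a b : ℤ), nest (K.map fun q m => fz 1 q (m - p)) a b =
        nest (K.map (fz 1)) (a - p) (b - p) := by
      intro K a b
      rw [nest_shift K _ p]
      simp only [add_sub_cancel_right]
    rw [if_pos rfl, hsh, hsh]
    have e2 : p - 1 - p = -1 := by ring
    have e3 : p - p = 0 := by ring
    rw [e2, e3]
    ring
  · intro m _ hm; rw [if_neg hm]; ring
  · intro h; exact absurd hp h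

/-! ### Assembly -/

/-- The algebra of the statement. -/
noncomputable def algA (r : ℕ) : Subring ℂ :=
  Subring.closure
        ((Subfield.closure {z : ℂ | IsRootOfUnity z} : Set ℂ)
          ∪ ({z : ℂ | ∃ K : List (ℕ × ℂ), K.length ≤ r - 1 ∧
              (∀ p ∈ K, 0 < p.1 ∧ IsRootOfUnity p.2) ∧
              (∀ p ∈ K.getLast?, ¬(p.1 = 1 ∧ p.2 = 1)) ∧ z = cmzv K}
            ∪ {z : ℂ | ∃ K : List (ℕ × ℂ), K.length ≤ r - 1 ∧
              (∀ p ∈ K, 0 < p.1 ∧ IsRootOfUnity p.2) ∧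
              (∀ p ∈ K.getLast?, ¬(p.1 = 1 ∧ p.2 = 1)) ∧ z = tval K}))

/-- Admissible lists. -/
def Adm (K : List (ℕ × ℂ)) : Prop :=
  (∀ p ∈ K, 0 < p.1 ∧ IsRootOfUnity p.2) ∧ (∀ p ∈ K.getLast?, ¬(p.1 = 1 ∧ p.2 = 1))

theorem IsRootOfUnity.inv {z : ℂ} (h : IsRootOfUnity z) : IsRootOfUnity z⁻¹ := by
  obtain ⟨N, hN, h⟩ := h
  exact ⟨N, hN, by rw [inv_pow, h, inv_one]⟩

theorem IsRootOfUnity.mul {z w : ℂ} (h : IsRootOfUnity z) (h' : IsRootOfUnity w) :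
    IsRootOfUnity (z * w) := by
  obtain ⟨N, hN, h⟩ := h
  obtain ⟨M, hM, h'⟩ := h'
  refine ⟨N * M, by positivity, ?_⟩
  rw [mul_pow, pow_mul, h, mul_comm N M, pow_mul, h', one_pow, one_pow, one_mul]

theorem IsRootOfUnity.prod {ι : Type*} (s : Finset ι) (f : ι → ℂ)
    (h : ∀ i ∈ s, IsRootOfUnity (f i)) : IsRootOfUnity (∏ i ∈ s, f i) := by
  classical
  induction s using Finset.induction_on with
  | empty => exact ⟨1, one_pos, by simp⟩
  | insert a s ha ih =>
    rw [Finset.prod_insert ha]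
    exact (h a (by simp)).mul (ih fun i hi => h i (by simp [hi]))

theorem algA_K {r : ℕ} {z : ℂ} (h : z ∈ Subfield.closure {z : ℂ | IsRootOfUnity z}) :
    z ∈ algA r := Subring.subset_closure (Or.inl h)

theorem algA_root {r : ℕ} {z : ℂ} (h : IsRootOfUnity z) : z ∈ algA r :=
  algA_K (Subfield.subset_closure h)

theorem algA_z {r : ℕ} {K : List (ℕ × ℂ)} (h : Adm K) (hl : K.length ≤ r - 1) :
    cmzv K ∈ algA r := Subring.subset_closure (Or.inr (Or.inl ⟨K, hl, h.1, h.2, rfl⟩))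

theorem algA_t {r : ℕ} {K : List (ℕ × ℂ)} (h : Adm K) (hl : K.length ≤ r - 1) :
    tval K ∈ algA r := Subring.subset_closure (Or.inr (Or.inr ⟨K, hl, h.1, h.2, rfl⟩))

theorem algA_neg_one_pow {r : ℕ} (n : ℕ) : ((-1 : ℂ)) ^ n ∈ algA r :=
  Subring.pow_mem _ (Subring.neg_mem _ (Subring.one_mem _)) _

theorem adm_drop {K : List (ℕ × ℂ)} (h : Adm K) (i : ℕ) : Adm (K.drop i) := by
  refine ⟨fun p hp => h.1 p (List.mem_of_mem_drop hp), fun p hp => ?_⟩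
  rw [List.getLast?_drop] at hp
  split_ifs at hp with h1
  · simp at hp
  · exact h.2 p hp

theorem adm_inv_take {K : List (ℕ × ℂ)} (h : Adm K)
    (hh : ∀ p ∈ K.head?, ¬(p.1 = 1 ∧ p.2 = 1)) (i : ℕ) : Adm (invL (K.take i)) := by
  refine ⟨fun p hp => ?_, fun p hp => ?_⟩
  · rw [invL, List.mem_map] at hp
    obtain ⟨q, hq, rfl⟩ := hp
    have := h.1 q (List.mem_of_mem_take (List.mem_reverse.mp hq))
    exact ⟨this.1, this.2.inv⟩
  · rw [invL, List.map_reverse, List.getLast?_reverse, List.head?_map, List.head?_take] at hp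
    split_ifs at hp with h1
    · simp at hp
    · rw [Option.mem_def, Option.map_eq_some_iff] at hp
      obtain ⟨q, hq, rfl⟩ := hp
      have := hh q hq
      simpa using this

theorem length_invL (K : List (ℕ × ℂ)) : (invL K).length = K.length := by simp [invL]

theorem adm_ofFn {r : ℕ} (k : Fin r → ℕ) (x : Fin r → ℂ) (hk : ∀ i, 0 < k i)
    (hx : ∀ i, IsRootOfUnity (x i)) (hl : ∀ i : Fin r, i.val + 1 = r → ¬(k i = 1 ∧ x i = 1)) :
    Adm (List.ofFn fun i => (k i, x i)) := by
  refine ⟨fun p hp => ?_, fun p hp => ?_⟩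
  · rw [List.mem_ofFn] at hp
    obtain ⟨i, rfl⟩ := hp
    exact ⟨hk i, hx i⟩
  · rw [List.getLast?_eq_getElem?, Option.mem_def, List.getElem?_eq_some_iff] at hp
    obtain ⟨h1, rfl⟩ := hp
    simp only [List.getElem_ofFn, List.length_ofFn] at h1 ⊢
    exact hl _ (by simp; omega)

theorem head_ofFn {r : ℕ} (k : Fin r → ℕ) (x : Fin r → ℂ)
    (hl : ∀ i : Fin r, i.val = 0 → ¬(k i = 1 ∧ x i = 1)) :
    ∀ p ∈ (List.ofFn fun i => (k i, x i)).head?, ¬(p.1 = 1 ∧ p.2 = 1) := by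
  intro p hp
  rw [List.head?_eq_getElem?, Option.mem_def, List.getElem?_eq_some_iff] at hp
  obtain ⟨h1, rfl⟩ := hp
  simp only [List.getElem_ofFn, List.length_ofFn] at h1 ⊢
  exact hl _ rfl

theorem algA_list_prod {r : ℕ} (K : List (ℕ × ℂ)) (c : ℕ × ℂ → ℂ) (h : ∀ p ∈ K, c p ∈ algA r) :
    (K.map c).prod ∈ algA r := by
  refine Subring.list_prod_mem _ fun z hz => ?_
  rw [List.mem_map] at hz
  obtain ⟨p, hp, rfl⟩ := hz
  exact h p hp

theorem bil_one (X : ℂ) (hX : IsRootOfUnity X) (hX1 : X ≠ 1) (l : ℕ) (hl : 1 ≤ l) (r : ℕ)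
    (hr : 2 ≤ r) : ∃ z ∈ algA r,
    Tendsto (fun N : ℕ => ∑ n ∈ Finset.Ioc (-(N : ℤ)) N, fz (1 / 2) (l, X) n) atTop (nhds z) := by
  have a1 : Adm [(l, X)] := ⟨by simpa using ⟨hl, hX⟩, by simpa using fun _ => hX1⟩
  have a2 : Adm [(l, X⁻¹)] := ⟨by simpa using ⟨hl, hX.inv⟩, by simpa using fun _ => hX1⟩
  refine ⟨((-1) ^ l * X) * tval [(l, X⁻¹)] + tval [(l, X)], ?_, ?_⟩
  · exact Subring.add_mem _ (Subring.mul_mem _ (Subring.mul_mem _ (algA_neg_one_pow l)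
      (algA_root hX)) (algA_t a2 (by simp; omega))) (algA_t a1 (by simp; omega))
  · have t1 := (rate_t _ a1.1 a1.2).tendsto
    have t2 := (rate_t _ a2.1 a2.2).tendsto
    refine ((t2.const_mul ((-1) ^ l * X)).add t1).congr fun N => ?_
    have h := nest_half_reflect [(l, X)] (by simpa using hX.ne_zero) N
    have e : invL [(l, X)] = [(l, X⁻¹)] := rfl
    rw [e] at h
    simp only [List.map_cons, List.map_nil, List.prod_cons, List.prod_nil, mul_one] at h ⊢
    rw [← h]
    simp only [nest_cons, nest_nil, mul_one]
    rw [← sum_Ioc_split _ (by omega) (by omega)]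

theorem pivot_lim {r : ℕ} (hr : 2 ≤ r) (k : Fin r → ℕ) (x : Fin r → ℂ) (hk : ∀ i, 0 < k i)
    (hx : ∀ i, IsRootOfUnity (x i)) (hf : ∀ i : Fin r, i.val = 0 → ¬(k i = 1 ∧ x i = 1))
    (hl : ∀ i : Fin r, i.val + 1 = r → ¬(k i = 1 ∧ x i = 1)) (hX : ∏ i, x i ≠ 1)
    (j : Fin r) (l : ℕ) (e : Fin r → ℕ) (hl1 : 1 ≤ l) (he : ∀ i, k i ≤ e i) :
    ∃ z ∈ algA r, Tendsto (fun N : ℕ => ∑ n ∈ tup r (-(N : ℤ)) N, (∏ i, x i ^ (n i)) *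
      pfG j l e (fun i => (n i : ℂ) + 1 / 2 - 1)) atTop (nhds z) := by
  set Kd := List.ofFn fun i => (e i, x i) with hKd
  have ha : Adm Kd := adm_ofFn e x (fun i => (hk i).trans_le (he i)) hx fun i hi h =>
    hl i hi ⟨by have := hk i; have := he i; omega, h.2⟩
  have hh := head_ofFn e x fun i hi h =>
    hf i hi ⟨by have := hk i; have := he i; omega, h.2⟩
  have aR := adm_drop ha (j + 1)
  have aL := adm_inv_take ha hh j
  have hlen : Kd.length = r := by simp [hKd]
  have hj := j.2
  have rR := rate_z _ aR.1 aR.2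
  have rL := rate_z _ aL.1 aL.2
  have hXr : IsRootOfUnity (∏ i, x i) := IsRootOfUnity.prod _ _ fun i _ => hx i
  obtain ⟨w, hw, hwt⟩ := bil_one _ hXr hX l hl1 r hr
  have g1 : ∀ (X : ℂ), IsRootOfUnity X → ∀ i : ℕ,
      ‖fz (1 / 2) (l, X) ((i : ℤ) + 1)‖ ≤ 2 ^ l / ((i : ℝ) + 1) := fun X hX i => by
    have := norm_fz (le_refl (1 / 2 : ℝ)) (l, X) hX.norm i 1 hl1
    rw [pow_one] at this
    push_cast at this
    exact this
  have hconv := conv_lemma _ _ _ _ rL rR (fz (1 / 2) (l, ∏ i, x i)) (2 ^ l) (by positivity)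
    (g1 _ hXr) (fun i => by
      have h := fz_half_reflect (l, ∏ i, x i) hXr.ne_zero ((i : ℤ) + 1)
      have e1 : (1 - ((i : ℤ) + 1)) = -(i : ℤ) := by ring
      rw [e1] at h
      rw [h, norm_mul, norm_mul, norm_pow, norm_neg, norm_one, one_pow, hXr.norm, one_mul, one_mul]
      exact g1 _ hXr.inv i)
  have hlim := (hconv.add (hwt.const_mul (cmzv (invL (Kd.take j)) * cmzv (Kd.drop (j + 1))))).const_mul
    ((Kd.take j).map fun p => (-1 : ℂ) ^ p.1).prod
  refine ⟨_, ?_, hlim.congr fun N => ?_⟩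
  · rw [zero_add]
    refine Subring.mul_mem _ (algA_list_prod _ _ fun p _ => algA_neg_one_pow _)
      (Subring.mul_mem _ (Subring.mul_mem _ (algA_z aL ?_) (algA_z aR ?_)) hw)
    · rw [length_invL, List.length_take]; omega
    · rw [List.length_drop]; omega
  · rw [pivot r j l e x (fun i => (hx i).ne_zero)]
    rw [sub_add_cancel, Finset.mul_sum]
    refine Finset.sum_congr rfl fun p hp => ?_
    rw [Finset.mem_Ioc] at hp
    have e1 : -(N : ℤ) - p = -((N : ℤ) + p) := by ring
    rw [e1, nest_one_reflect]
    have e2 : ((((N : ℤ) + p - 1).toNat : ℕ) : ℤ) = (N : ℤ) + p - 1 := by omega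
    have e3 : ((((N : ℤ) - p).toNat : ℕ) : ℤ) = (N : ℤ) - p := by omega
    rw [e2, e3]
    ring

theorem bil_lim {r : ℕ} (hr : 2 ≤ r) (k : Fin r → ℕ) (x : Fin r → ℂ) (hk : ∀ i, 0 < k i)
    (hx : ∀ i, IsRootOfUnity (x i)) (hf : ∀ i : Fin r, i.val = 0 → ¬(k i = 1 ∧ x i = 1))
    (hl : ∀ i : Fin r, i.val + 1 = r → ¬(k i = 1 ∧ x i = 1)) (hX : ∏ i, x i ≠ 1) :
    ∃ z ∈ algA r, Tendsto (fun N : ℕ =>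
      nest ((List.ofFn fun i => (k i, x i)).map (fz (1 / 2))) (-(N : ℤ)) N) atTop (nhds z) := by
  obtain ⟨G, hG, hGy⟩ := pf_exists (by omega : 0 < r) _ k hk rfl
  have main : ∃ z ∈ algA r, Tendsto (fun N : ℕ => ∑ n ∈ tup r (-(N : ℤ)) N, (∏ i, x i ^ (n i)) *
      G (fun i => (n i : ℂ) + 1 / 2 - 1)) atTop (nhds z) := by
    clear hGy
    refine Submodule.span_induction ?_ ?_ ?_ ?_ hG
    · rintro _ ⟨j, l, e, hl1, he, rfl⟩
      have h := pivot_lim hr k x hk hx hf hl hX j l (Function.update e j (k j)) hl1 (fun i => by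
        by_cases h : i = j
        · subst h; simp
        · rw [Function.update_of_ne h]; exact he i h)
      have e1 : pfG j l (Function.update e j (k j)) = pfG j l e := by
        funext y
        rw [pfG, pfG]
        congr 1
        refine Finset.prod_congr rfl fun i hi => ?_
        rw [Function.update_of_ne (Finset.ne_of_mem_erase hi)]
      rw [e1] at h
      exact h
    · exact ⟨0, Subring.zero_mem _, by simp⟩
    · rintro F1 F2 _ _ ⟨z1, h1, t1⟩ ⟨z2, h2, t2⟩
      refine ⟨z1 + z2, Subring.add_mem _ h1 h2, (t1.add t2).congr fun N => ?_⟩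
      rw [← Finset.sum_add_distrib]
      exact Finset.sum_congr rfl fun n _ => by rw [Pi.add_apply]; ring
    · rintro c F1 _ ⟨z1, h1, t1⟩
      refine ⟨c * z1, Subring.mul_mem _ (algA_K ?_) h1, (t1.const_mul (c : ℂ)).congr fun N => ?_⟩
      · exact SubfieldClass.ratCast_mem _ c
      · rw [Finset.mul_sum]
        exact Finset.sum_congr rfl fun n _ => by rw [Pi.smul_apply, Rat.smul_def]; ring
  obtain ⟨z, hz, ht⟩ := main
  refine ⟨z, hz, ht.congr fun N => ?_⟩
  rw [List.map_ofFn, ← nest_ofFn]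
  refine Finset.sum_congr rfl fun n hn => ?_
  have hn := (mem_tup.mp hn).2
  rw [← hGy, ← Finset.prod_mul_distrib]
  · rfl
  · intro a b hab
    have hab : (n a : ℂ) + 1 / 2 - 1 = (n b : ℂ) + 1 / 2 - 1 := hab
    have : (n a : ℂ) = n b := by linear_combination hab
    exact hn.injective (by exact_mod_cast this)
  · intro i h
    have h2 : (2 * n i : ℂ) = 1 := by linear_combination 2 * h
    have h3 : 2 * n i = 1 := by exact_mod_cast h2
    omega

theorem main_fin {r : ℕ} (hr : 2 ≤ r) (k : Fin r → ℕ) (x : Fin r → ℂ) (hk : ∀ i, 0 < k i)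
    (hx : ∀ i, IsRootOfUnity (x i)) (hf : ∀ i : Fin r, i.val = 0 → ¬(k i = 1 ∧ x i = 1))
    (hl : ∀ i : Fin r, i.val + 1 = r → ¬(k i = 1 ∧ x i = 1)) (hX : ∏ i, x i ≠ 1) :
    tval (List.ofFn fun i => (k i, x i)) + (-1) ^ (∑ i, k i) * (∏ i, x i) *
      tval (invL (List.ofFn fun i => (k i, x i))) ∈ algA r := by
  obtain ⟨z, hz, ht⟩ := bil_lim hr k x hk hx hf hl hX
  have ha := adm_ofFn k x hk hx hl
  have hh := head_ofFn k x hf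
  have hcp : ((List.ofFn fun i => (k i, x i)).map fun p => (-1 : ℂ) ^ p.1 * p.2).prod
      = (-1) ^ (∑ i, k i) * (∏ i, x i) := by
    rw [List.map_ofFn, List.prod_ofFn, ← Finset.prod_pow_eq_pow_sum, ← Finset.prod_mul_distrib]
    rfl
  have hlen : (List.ofFn fun i => (k i, x i)).length = r := by simp
  generalize (List.ofFn fun i => (k i, x i)) = L at *
  have t2 : Tendsto (fun N : ℕ => nest (L.map (fz (1 / 2))) (-(N : ℤ)) N) atTop
      (nhds (∑ i ∈ Finset.range (r + 1), ((L.take i).map fun p => (-1 : ℂ) ^ p.1 * p.2).prod *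
        tval (invL (L.take i)) * tval (L.drop i))) := by
    have t3 := tendsto_finsetSum (Finset.range (r + 1)) fun i _ =>
      (((rate_t _ (adm_inv_take ha hh i).1 (adm_inv_take ha hh i).2).tendsto.const_mul
        ((L.take i).map fun p => (-1 : ℂ) ^ p.1 * p.2).prod).mul
        (rate_t _ (adm_drop ha i).1 (adm_drop ha i).2).tendsto)
    refine t3.congr fun N => ?_
    rw [nest_split (L.map (fz (1 / 2))) (c := 0) (by omega) (by omega), List.length_map, hlen]
    refine Finset.sum_congr rfl fun i _ => ?_
    rw [← List.map_take, ← List.map_drop, nest_half_reflect _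
      fun p hp => (ha.1 p (List.mem_of_mem_take hp)).2.ne_zero]
  have hu := tendsto_nhds_unique t2 ht
  obtain ⟨q, rfl⟩ : ∃ q, r = q + 1 := ⟨r - 1, by omega⟩
  rw [Finset.sum_range_succ, Finset.sum_range_succ', List.take_of_length_le hlen.le,
    List.drop_of_length_le hlen.le, hcp] at hu
  have hn1 : tval [] = 1 := by
    refine tendsto_nhds_unique (rate_t [] (by simp) (by simp)).tendsto ?_
    simp [nest_nil]
  simp only [List.take_zero, List.map_nil, List.prod_nil, List.drop_zero, one_mul,
    show invL [] = [] from rfl, hn1, mul_one] at hu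
  have hmid : ∑ i ∈ Finset.range q, ((L.take (i + 1)).map fun p => (-1 : ℂ) ^ p.1 * p.2).prod *
        tval (invL (L.take (i + 1))) * tval (L.drop (i + 1)) ∈ algA (q + 1) := by
    refine Subring.sum_mem _ fun i hi => ?_
    have hi := Finset.mem_range.mp hi
    refine Subring.mul_mem _ (Subring.mul_mem _ (algA_list_prod _ _ fun p hp =>
      Subring.mul_mem _ (algA_neg_one_pow _)
        (algA_root (ha.1 p (List.mem_of_mem_take hp)).2))
      (algA_t (adm_inv_take ha hh _) ?_)) (algA_t (adm_drop ha _) ?_)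
    · rw [length_invL, List.length_take]; omega
    · rw [List.length_drop]; omega
  have := Subring.sub_mem _ hz hmid
  rw [← hu] at this
  convert this using 1
  ring

theorem symmetry_cmtv_mod_products (r : ℕ) (hr : 2 ≤ r) (k : ℕ → ℕ) (x : ℕ → ℂ)
    (hk : ∀ i, 1 ≤ i → i ≤ r → 0 < k i)
    (hx : ∀ i, 1 ≤ i → i ≤ r → IsRootOfUnity (x i))
    (h1 : ¬(k 1 = 1 ∧ x 1 = 1)) (hrr : ¬(k r = 1 ∧ x r = 1))
    (hX : (∏ i ∈ Finset.Icc 1 r, x i) ≠ 1) :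
    tval (List.ofFn fun i : Fin r => (k (i.val + 1), x (i.val + 1)))
      - (-1 : ℂ) ^ ((∑ i ∈ Finset.Icc 1 r, k i) - 1)
        * (∏ i ∈ Finset.Icc 1 r, x i)
        * tval (List.ofFn fun i : Fin r => (k (r - i.val), (x (r - i.val))⁻¹))
    ∈ Subring.closure
        ((Subfield.closure {z : ℂ | IsRootOfUnity z} : Set ℂ)
          ∪ ({z : ℂ | ∃ K : List (ℕ × ℂ), K.length ≤ r - 1 ∧
              (∀ p ∈ K, 0 < p.1 ∧ IsRootOfUnity p.2) ∧
              (∀ p ∈ K.getLast?, ¬(p.1 = 1 ∧ p.2 = 1)) ∧ z = cmzv K}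
            ∪ {z : ℂ | ∃ K : List (ℕ × ℂ), K.length ≤ r - 1 ∧
              (∀ p ∈ K, 0 < p.1 ∧ IsRootOfUnity p.2) ∧
              (∀ p ∈ K.getLast?, ¬(p.1 = 1 ∧ p.2 = 1)) ∧ z = tval K})) := by
  have hp : ∏ i ∈ Finset.Icc 1 r, x i = ∏ i : Fin r, x (i.val + 1) := by
    rw [Fin.prod_univ_eq_prod_range (fun i => x (i + 1)), ← Finset.Ico_add_one_right_eq_Icc,
      Finset.prod_Ico_eq_prod_range]
    simp [add_comm]
  have hs : ∑ i ∈ Finset.Icc 1 r, k i = ∑ i : Fin r, k (i.val + 1) := by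
    rw [Fin.sum_univ_eq_sum_range (fun i => k (i + 1)), ← Finset.Ico_add_one_right_eq_Icc,
      Finset.sum_Ico_eq_sum_range]
    simp [add_comm]
  have h := main_fin hr (fun i => k (i.val + 1)) (fun i => x (i.val + 1))
    (fun i => hk _ (by omega) (by omega)) (fun i => hx _ (by omega) (by omega))
    (fun i hi => by simpa [hi] using h1) (fun i hi => by simpa [hi] using hrr) (by rwa [← hp])
  have hL : (List.ofFn fun i : Fin r => (k (r - i.val), (x (r - i.val))⁻¹)) =
      invL (List.ofFn fun i : Fin r => (k (i.val + 1), x (i.val + 1))) := by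
    apply List.ext_getElem
    · simp [invL]
    · intro i h1 h2
      have hi : i < r := by simpa using h1
      have e : r - 1 - i + 1 = r - i := by omega
      simp [invL, e]
  have hpos : 0 < ∑ i : Fin r, k (i.val + 1) := by
    have h0 := Finset.single_le_sum (f := fun i : Fin r => k (i.val + 1)) (fun i _ => Nat.zero_le _)
      (Finset.mem_univ (⟨0, by omega⟩ : Fin r))
    have := hk 1 le_rfl (by omega)
    exact this.trans_le h0
  rw [hp, hs, hL]
  obtain ⟨s, hs'⟩ : ∃ s, ∑ i : Fin r, k (i.val + 1) = s + 1 := ⟨_, (Nat.succ_pred_eq_of_pos hpos).symm⟩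
  rw [hs'] at h ⊢
  have h2 : tval (List.ofFn fun i : Fin r => (k (i.val + 1), x (i.val + 1))) -
      (-1) ^ (s + 1 - 1) * (∏ i : Fin r, x (i.val + 1)) *
        tval (invL (List.ofFn fun i : Fin r => (k (i.val + 1), x (i.val + 1)))) =
      tval (List.ofFn fun i : Fin r => (k (i.val + 1), x (i.val + 1))) +
      (-1) ^ (s + 1) * (∏ i : Fin r, x (i.val + 1)) *
        tval (invL (List.ofFn fun i : Fin r => (k (i.val + 1), x (i.val + 1)))) := by
    rw [Nat.add_sub_cancel, pow_succ]; ring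
  rw [h2]
  exact h
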